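/- Let x be a singular modulus of discriminant Δ with |Δ| ≥ 11, and let n be a non-zero integer. Then ℚ(x) = ℚ(xⁿ). -/

import Mathlib

/-- The Eisenstein-series quantity `g₂(τ) = 60 ∑' 1/(m+nτ)⁴` (junk value off `ℍ`). -/
noncomputable def g2 (τ : ℂ) : ℂ :=
  60 * ∑' p : ℤ × ℤ, if p = 0 then 0 else (((p.1 : ℂ) + (p.2 : ℂ) * τ) ^ 4)⁻¹

/-- The Eisenstein-series quantity `g₃(τ) = 140 ∑' 1/(m+nτ)⁶` (junk value off `ℍ`). -/
noncomputable def g3 (τ : ℂ) : ℂ :=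
  140 * ∑' p : ℤ × ℤ, if p = 0 then 0 else (((p.1 : ℂ) + (p.2 : ℂ) * τ) ^ 6)⁻¹

/-- Klein's modular `j`-invariant `j = 1728 g₂³ / (g₂³ - 27 g₃²)`. -/
noncomputable def klein (τ : ℂ) : ℂ :=
  1728 * g2 τ ^ 3 / (g2 τ ^ 3 - 27 * g3 τ ^ 2)

/-- `x` is a singular modulus of discriminant `Δ`: `x = j(τ)` where `τ` lies in the upper
half-plane and is a root of a primitive integer quadratic `aX² + bX + c` (with `a > 0`) of
discriminant `Δ = b² - 4ac`. -/
def IsSingularModulus (x : ℂ) (Δ : ℤ) : Prop :=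
  ∃ τ : ℂ, 0 < τ.im ∧
    (∃ a b c : ℤ, 0 < a ∧ Int.gcd a (Int.gcd b c) = 1 ∧
      (a : ℂ) * τ ^ 2 + (b : ℂ) * τ + (c : ℂ) = 0 ∧ Δ = b ^ 2 - 4 * a * c) ∧
    x = klein τ

namespace SingularModuli

open Filter ModularForm EisensteinSeries Complex MatrixGroups Function Polynomial
open UpperHalfPlane hiding I
open scoped Real Manifold

local notation "𝕢" => Function.Periodic.qParam

/-- The modular `j`-function on the upper half-plane. -/
noncomputable def jInv (τ : ℍ) : ℂ := E₄ τ ^ 3 / discriminant τ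

lemma tsum_lattice_eq {k : ℕ} (hk : 3 ≤ k) (τ : ℍ) :
    ∑' p : ℤ × ℤ, (if p = 0 then 0 else (((p.1 : ℂ) + (p.2 : ℂ) * τ) ^ k)⁻¹) =
      2 * riemannZeta k * ModularForm.E hk τ := by
  have h1 : ModularForm.E hk τ = (1 / 2 : ℂ) • eisensteinSeriesSIF (N := 1) 0 k τ := rfl
  have h2 := tsum_eisSummand_eq_riemannZeta_mul_eisensteinSeries hk τ
  rw [h1, eisensteinSeriesSIF_apply, smul_eq_mul]
  calc _ = ∑' v : Fin 2 → ℤ, eisSummand k v τ := by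
        rw [← (finTwoArrowEquiv ℤ).symm.tsum_eq, ← (Equiv.prodComm ℤ ℤ).tsum_eq]
        refine tsum_congr fun p ↦ ?_
        obtain ⟨a, b⟩ := p
        simp only [Equiv.prodComm_apply, Prod.swap_prod_mk, eisSummand, finTwoArrowEquiv_symm_apply,
          Matrix.cons_val_zero, Matrix.cons_val_one, zpow_neg, zpow_natCast]
        by_cases h : (b, a) = 0
        · simp only [Prod.mk_eq_zero] at h
          simp [h.1, h.2, show k ≠ 0 by omega]
        · exact (if_neg h).trans (congrArg (fun z : ℂ ↦ (z ^ k)⁻¹) (add_comm _ _))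
    _ = _ := by rw [h2]; ring

lemma riemannZeta_six : riemannZeta 6 = π ^ 6 / 945 := by
  have := riemannZeta_two_mul_nat (k := 3) (by norm_num)
  have hb : _root_.bernoulli 6 = 1 / 42 := by decide +kernel
  norm_num [Nat.factorial] at this
  rw [hb] at this
  push_cast at this
  rw [this]; ring

lemma klein_coe (τ : ℍ) : klein τ = jInv τ := by
  have h4 : g2 τ = 4 * π ^ 4 / 3 * E₄ τ := by
    have := tsum_lattice_eq (k := 4) (by norm_num) τ
    rw [g2, this]
    have h := riemannZeta_four
    push_cast
    rw [h]; ring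
  have h6 : g3 τ = 8 * π ^ 6 / 27 * E₆ τ := by
    have := tsum_lattice_eq (k := 6) (by norm_num) τ
    rw [g3, this]
    push_cast
    rw [riemannZeta_six]; ring
  have hpi : (π : ℂ) ≠ 0 := by exact_mod_cast Real.pi_ne_zero
  have hd := discriminant_eq_E₄_cube_sub_E₆_sq τ
  have hne := discriminant_ne_zero τ
  rw [klein, h4, h6, jInv]
  have h3 : (4 * (π:ℂ) ^ 4 / 3 * E₄ τ) ^ 3 - 27 * (8 * π ^ 6 / 27 * E₆ τ) ^ 2 =
      64 * π ^ 12 / 27 * (1728 * discriminant τ) := by rw [hd]; ring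
  rw [h3]
  field_simp
  ring

lemma jInv_smul (γ : SL(2, ℤ)) (τ : ℍ) : jInv (γ • τ) = jInv τ := by
  have hd := SlashInvariantForm.slash_action_eqn'' (k := 12) CuspForm.discriminant
    (Γ := 𝒮ℒ) ⟨γ, rfl⟩ τ
  have h4 : E₄ (γ • τ) = denom γ τ ^ (4 : ℤ) * E₄ τ :=
    SlashInvariantForm.slash_action_eqn'' (k := 4) E₄ (Γ := 𝒮ℒ) ⟨γ, rfl⟩ τ
  have hd' : discriminant (γ • τ) = denom γ τ ^ (12 : ℤ) * discriminant τ := hd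
  rw [jInv, jInv, hd', h4]
  have := denom_ne_zero γ τ
  have := discriminant_ne_zero τ
  field_simp

lemma mdifferentiable_jInv : MDiff jInv := by
  have h4 := E₄.holo'
  have hd := CuspForm.discriminant.holo'
  rw [UpperHalfPlane.mdifferentiable_iff] at *
  intro z hz
  refine DifferentiableWithinAt.div ((h4 z hz).pow 3) (hd z hz) (discriminant_ne_zero _)

/-- `f` is given on the upper half-plane by the power series `φ` in `exp (2πiτ/N)`. -/
def HasQ (N : ℕ) (φ : PowerSeries ℂ) (f : ℍ → ℂ) : Prop :=
  ∀ τ : ℍ, HasSum (fun n ↦ φ.coeff n * 𝕢 N τ ^ n) (f τ)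

namespace HasQ

variable {N : ℕ} {φ ψ : PowerSeries ℂ} {f g : ℍ → ℂ}

lemma add (hf : HasQ N φ f) (hg : HasQ N ψ g) : HasQ N (φ + ψ) (f + g) := fun τ ↦ by
  simpa [add_mul] using (hf τ).add (hg τ)

lemma mul (hf : HasQ N φ f) (hg : HasQ N ψ g) : HasQ N (φ * ψ) (f * g) := fun τ ↦ by
  have h1 := (hf τ).summable.norm
  have h2 := (hg τ).summable.norm
  have h3 := (summable_norm_sum_mul_antidiagonal_of_summable_norm h1 h2).of_norm.hasSum
  rw [← tsum_mul_tsum_eq_tsum_sum_antidiagonal_of_summable_norm h1 h2, (hf τ).tsum_eq,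
    (hg τ).tsum_eq] at h3
  rw [HasSum, Pi.mul_apply, show (fun n ↦ (PowerSeries.coeff n) (φ * ψ) * 𝕢 N τ ^ n) = _ from
    funext fun n ↦ ?_]
  · exact h3
  rw [PowerSeries.coeff_mul, Finset.sum_mul]
  refine Finset.sum_congr rfl fun p hp ↦ ?_
  rw [← Finset.HasAntidiagonal.mem_antidiagonal.mp hp, pow_add]
  ring

lemma monomial_mul_qParam (N k : ℕ) (c : ℂ) :
    HasQ N (PowerSeries.monomial k c) (fun τ ↦ c * 𝕢 N τ ^ k) := fun τ ↦ by
  convert hasSum_ite_eq k (c * 𝕢 N τ ^ k) using 2 with n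
  rw [PowerSeries.coeff_monomial]
  split_ifs with h <;> simp [h]

lemma const (N : ℕ) (c : ℂ) : HasQ N (PowerSeries.C c) (fun _ ↦ c) := by
  simpa using monomial_mul_qParam N 0 c

lemma qParam_pow (N k : ℕ) : HasQ N (PowerSeries.X ^ k) (fun τ ↦ 𝕢 N τ ^ k) := by
  simpa [PowerSeries.X_pow_eq] using monomial_mul_qParam N k 1

lemma const_mul (c : ℂ) (hf : HasQ N φ f) : HasQ N (PowerSeries.C c * φ) (fun τ ↦ c * f τ) :=
  (const N c).mul hf

lemma neg (hf : HasQ N φ f) : HasQ N (-φ) (-f) := by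
  convert const_mul (-1) hf using 1
  · simp
  · ext; simp

lemma sub (hf : HasQ N φ f) (hg : HasQ N ψ g) : HasQ N (φ - ψ) (f - g) := by
  simpa only [sub_eq_add_neg] using hf.add hg.neg

lemma pow (hf : HasQ N φ f) (k : ℕ) : HasQ N (φ ^ k) (f ^ k) := by
  induction k with
  | zero => simpa only [pow_zero, map_one] using! const N 1
  | succ k ih => simpa only [pow_succ] using ih.mul hf

lemma sum {ι : Type*} (s : Finset ι) {Φ : ι → PowerSeries ℂ} {F : ι → ℍ → ℂ}
    (h : ∀ i ∈ s, HasQ N (Φ i) (F i)) : HasQ N (∑ i ∈ s, Φ i) (∑ i ∈ s, F i) := fun τ ↦ by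
  simpa [Finset.sum_mul] using hasSum_sum fun i hi ↦ h i hi τ

lemma eq_zero (hN : N ≠ 0) (h : HasQ N φ 0) : φ = 0 := by
  have hr : (0 : ℝ) < N := by positivity
  have h0 : cuspFunction (N : ℝ) (0 : ℍ → ℂ) = 0 := by
    simpa [cuspFunction, Periodic.cuspFunction]
      using! (tendsto_const_nhds.mono_left nhdsWithin_le_nhds).limUnder_eq
  have ha : AnalyticAt ℂ (cuspFunction (N : ℝ) (0 : ℍ → ℂ)) 0 := by
    rw [h0]
    exact analyticAt_const
  ext n
  have := qExpansion_coeff_unique (0 : ModularForm 𝒮ℒ 0) hr ha (c := fun n ↦ φ.coeff n) h n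
  rw [this, FunLike.coe_zero, qExpansion_zero]

lemma unique (hN : N ≠ 0) (h : HasQ N φ f) (h' : HasQ N ψ f) : φ = ψ := by
  have := h.sub h'
  rw [sub_self] at this
  exact sub_eq_zero.mp (this.eq_zero hN)

end HasQ

/-- Power series all of whose coefficients lie in the subring `R`. -/
noncomputable def seriesOver (R : Subring ℂ) : Subring (PowerSeries ℂ) :=
  (PowerSeries.map R.subtype).range

lemma mem_seriesOver {R : Subring ℂ} {φ : PowerSeries ℂ} :
    φ ∈ seriesOver R ↔ ∀ n, φ.coeff n ∈ R := by
  constructor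
  · rintro ⟨ψ, rfl⟩ n
    simp
  · intro h
    exact ⟨PowerSeries.mk fun n ↦ ⟨φ.coeff n, h n⟩, by ext; simp⟩

lemma seriesOver_mono {R S : Subring ℂ} (h : R ≤ S) : seriesOver R ≤ seriesOver S :=
  fun _ hφ ↦ mem_seriesOver.mpr fun n ↦ h (mem_seriesOver.mp hφ n)

/-- The integers as a subring of `ℂ`. -/
def intSubring : Subring ℂ := (Int.castRingHom ℂ).range

lemma map_int_mem_seriesOver (φ : PowerSeries ℤ) :
    PowerSeries.map (Int.castRingHom ℂ) φ ∈ seriesOver intSubring :=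
  mem_seriesOver.mpr fun n ↦ ⟨φ.coeff n, by simp⟩

open ArithmeticFunction in
/-- The series `∑ σ_k(n) Xⁿ`. -/
def sigmaSeries (k : ℕ) : PowerSeries ℤ := PowerSeries.mk fun n ↦ (ArithmeticFunction.sigma k n : ℤ)

lemma hasQ_E₄ : HasQ 1 (PowerSeries.map (Int.castRingHom ℂ)
    (1 + 240 * sigmaSeries 3)) E₄ := fun τ ↦ by
  have h := ModularForm.hasSum_qExpansion E₄ one_pos one_mem_strictPeriods_SL τ
  convert h using 2 with n
  have hb : _root_.bernoulli 4 = -1 / 30 := by decide +kernel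
  rw [E_qExpansion_coeff _ ⟨2, rfl⟩, hb]
  rw [PowerSeries.coeff_map, show (240 : PowerSeries ℤ) = PowerSeries.C 240 from
    (map_ofNat _ _).symm, map_add, PowerSeries.coeff_one, PowerSeries.coeff_C_mul, sigmaSeries,
    PowerSeries.coeff_mk]
  by_cases hn : n = 0
  · simp [hn]
  · norm_num [hn]

lemma hasQ_E₆ : HasQ 1 (PowerSeries.map (Int.castRingHom ℂ)
    (1 - 504 * sigmaSeries 5)) E₆ := fun τ ↦ by
  have h := ModularForm.hasSum_qExpansion E₆ one_pos one_mem_strictPeriods_SL τ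
  convert h using 2 with n
  have hb : _root_.bernoulli 6 = 1 / 42 := by decide +kernel
  rw [E_qExpansion_coeff _ ⟨3, rfl⟩, hb]
  rw [PowerSeries.coeff_map, show (504 : PowerSeries ℤ) = PowerSeries.C 504 from
    (map_ofNat _ _).symm, map_sub, PowerSeries.coeff_one, PowerSeries.coeff_C_mul, sigmaSeries,
    PowerSeries.coeff_mk]
  by_cases hn : n = 0
  · simp [hn]
  · norm_num [hn]

lemma twelve_dvd_sigma (n : ℕ) :
    (12 : ℤ) ∣ 5 * ArithmeticFunction.sigma 3 n + 7 * ArithmeticFunction.sigma 5 n := by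
  simp only [ArithmeticFunction.sigma_apply, Nat.cast_sum, Finset.mul_sum, ← Finset.sum_add_distrib]
  refine Finset.dvd_sum fun d _ ↦ ?_
  refine (ZMod.intCast_zmod_eq_zero_iff_dvd _ 12).mp ?_
  push_cast
  generalize (d : ZMod 12) = x
  revert x
  decide

/-- The `q`-expansion of the discriminant form divided by `q` has integer coefficients. -/
lemma exists_discriminant_series : ∃ D : PowerSeries ℤ, D.coeff 0 = 1 ∧
    HasQ 1 (PowerSeries.map (Int.castRingHom ℂ) (PowerSeries.X * D)) discriminant := by
  set A := sigmaSeries 3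
  set B := sigmaSeries 5
  choose c hc using twelve_dvd_sigma
  set S : PowerSeries ℤ := PowerSeries.mk c
  have hS : 5 * A + 7 * B = 12 * S := by
    ext n
    rw [show (5 : PowerSeries ℤ) = PowerSeries.C 5 by simp,
      show (7 : PowerSeries ℤ) = PowerSeries.C 7 by simp,
      show (12 : PowerSeries ℤ) = PowerSeries.C 12 by simp]
    simp only [map_add, PowerSeries.coeff_C_mul, A, B, S, sigmaSeries, PowerSeries.coeff_mk]
    exact hc n
  set D₀ := S + 100 * A ^ 2 + 8000 * A ^ 3 - 147 * B ^ 2 with hD₀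
  have hA0 : PowerSeries.constantCoeff A = 0 := by
    simp [A, sigmaSeries, ← PowerSeries.coeff_zero_eq_constantCoeff_apply]
  have hB0 : PowerSeries.constantCoeff B = 0 := by
    simp [B, sigmaSeries, ← PowerSeries.coeff_zero_eq_constantCoeff_apply]
  obtain ⟨A', hA'⟩ := PowerSeries.X_dvd_iff.mpr hA0
  obtain ⟨B', hB'⟩ := PowerSeries.X_dvd_iff.mpr hB0
  have hS0 : PowerSeries.constantCoeff S = 0 := by
    have := hc 0
    simp at this
    simp [S, ← PowerSeries.coeff_zero_eq_constantCoeff_apply, this]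
  obtain ⟨S', hS'⟩ := PowerSeries.X_dvd_iff.mpr hS0
  have hS1 : S'.coeff 0 = 1 := by
    have h1 : S.coeff 1 = 1 := by
      have := hc 1
      simp at this
      simp only [S, PowerSeries.coeff_mk]
      omega
    rwa [hS', ← zero_add 1, PowerSeries.coeff_succ_X_mul] at h1
  refine ⟨S' + PowerSeries.X * (100 * A' ^ 2 + 8000 * PowerSeries.X * A' ^ 3 - 147 * B' ^ 2),
    ?_, ?_⟩
  · simpa using hS1
  · have h1 := (hasQ_E₄.pow 3).sub (hasQ_E₆.pow 2)
    have h2 := h1.const_mul (1 / 1728)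
    convert h2 using 1
    · have : PowerSeries.map (Int.castRingHom ℂ) (1728 * (PowerSeries.X *
          (S' + PowerSeries.X * (100 * A' ^ 2 + 8000 * PowerSeries.X * A' ^ 3 - 147 * B' ^ 2)))) =
          (PowerSeries.map (Int.castRingHom ℂ)) (1 + 240 * A) ^ 3 -
           (PowerSeries.map (Int.castRingHom ℂ)) (1 - 504 * B) ^ 2 := by
        rw [← map_pow, ← map_pow, ← map_sub]
        congr 1
        have : S = PowerSeries.X * S' := hS'
        have hS2 : 1728 * S = 720 * A + 1008 * B := by linear_combination (-144) * hS
        rw [hS'] at hS2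
        rw [hA', hB'] at hS2 ⊢
        linear_combination hS2
      rw [← this, map_mul _ 1728, map_ofNat]
      have h3 : (1728 : PowerSeries ℂ) = PowerSeries.C 1728 := (map_ofNat _ _).symm
      rw [h3, ← mul_assoc, ← map_mul]
      norm_num
    · ext τ
      have := discriminant_eq_E₄_cube_sub_E₆_sq τ
      simp only [Pi.sub_apply, Pi.pow_apply]
      linear_combination this

lemma isBoundedAtImInfty_jInv_mul : IsBoundedAtImInfty (fun τ ↦ jInv τ * 𝕢 1 τ) := by
  have h4 : IsBoundedAtImInfty E₄ := ModularFormClass.bdd_at_infty E₄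
  have hd := exp_isBigO_discriminant
  have h3 : (fun τ : ℍ ↦ E₄ τ ^ 3 * (𝕢 1 τ / discriminant τ)) =O[atImInfty] (1 : ℍ → ℝ) := by
    have h5 : (fun τ : ℍ ↦ E₄ τ ^ 3) =O[atImInfty] (fun _ ↦ (1 : ℝ) ^ 3) :=
      Asymptotics.IsBigO.pow h4 3
    have h6 : (fun τ : ℍ ↦ 𝕢 1 τ / discriminant τ) =O[atImInfty] (fun _ ↦ (1 : ℝ)) := by
      have h7 : (fun τ : ℍ ↦ 𝕢 1 τ) =O[atImInfty] discriminant := by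
        refine Asymptotics.IsBigO.trans (.of_bound 1 (.of_forall fun τ ↦ ?_)) hd
        simp [Periodic.qParam, Complex.norm_exp]
      exact (h7.mul (Asymptotics.isBigO_refl (fun τ ↦ (discriminant τ)⁻¹) _)).congr
        (fun τ ↦ (div_eq_mul_inv _ _).symm) (fun τ ↦ mul_inv_cancel₀ (discriminant_ne_zero τ))
          |>.trans (Asymptotics.isBigO_of_le _ (by simp))
    exact (h5.mul h6).congr_right fun _ ↦ by simp
  refine h3.congr (fun τ ↦ ?_) fun _ ↦ rfl
  rw [jInv]; ring

lemma mdifferentiable_qParam (N : ℕ) : MDiff (fun τ : ℍ ↦ 𝕢 N τ) := by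
  rw [UpperHalfPlane.mdifferentiable_iff]
  refine ((Periodic.differentiable_qParam (h := N)).differentiableOn
    (s := {z | 0 < z.im})).congr fun z hz ↦ ?_
  simp [ofComplex_apply_of_im_pos hz]

lemma jInv_vadd_one (τ : ℍ) : jInv ((1 : ℝ) +ᵥ τ) = jInv τ := by
  rw [← modular_T_smul, jInv_smul]

lemma periodic_ofComplex {f : ℍ → ℂ} (h : ∀ τ : ℍ, f ((1 : ℝ) +ᵥ τ) = f τ) :
    Periodic (f ∘ ofComplex) (1 : ℝ) := by
  intro w
  by_cases hw : 0 < im w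
  · have : 0 < im (w + (1 : ℝ)) := by simp [hw]
    simp only [comp_apply, ofComplex_apply_of_im_pos this, ofComplex_apply_of_im_pos hw]
    rw [← h ⟨w, hw⟩]
    congr 1
    ext
    simp [add_comm]
  · have : im (w + (1 : ℝ)) ≤ 0 := by simpa using hw
    simp only [comp_apply, ofComplex_apply_of_im_nonpos this,
      ofComplex_apply_of_im_nonpos (not_lt.mp hw)]

lemma qParam_vadd_one (N : ℕ) (τ : ℍ) :
    𝕢 N ((1 : ℝ) +ᵥ τ : ℍ) = exp (2 * π * I / N) * 𝕢 N τ := by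
  simp only [Periodic.qParam, coe_vadd, ← Complex.exp_add]
  congr 1
  push_cast
  ring

lemma hasQ_of_bounded {f : ℍ → ℂ} (h : ∀ τ : ℍ, f ((1 : ℝ) +ᵥ τ) = f τ) (hf : MDiff f)
    (hb : IsBoundedAtImInfty f) : ∃ φ, HasQ 1 φ f :=
  ⟨qExpansion 1 f, fun τ ↦ by
    simpa using hasSum_qExpansion one_pos (by simpa using periodic_ofComplex h) hf hb τ⟩

/-- The `q`-expansion of `q j(τ)` has integer coefficients and constant term `1`. -/
lemma exists_jSeries : ∃ J : PowerSeries ℤ, J.coeff 0 = 1 ∧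
    HasQ 1 (PowerSeries.map (Int.castRingHom ℂ) J) (fun τ ↦ jInv τ * 𝕢 (1 : ℕ) τ) := by
  obtain ⟨φ, hφ⟩ := hasQ_of_bounded (f := fun τ ↦ jInv τ * 𝕢 (1 : ℕ) τ)
    (fun τ ↦ by
      rw [jInv_vadd_one, qParam_vadd_one]
      simp) (mdifferentiable_jInv.mul (mdifferentiable_qParam 1))
    (by simpa using isBoundedAtImInfty_jInv_mul)
  obtain ⟨D, hD0, hD⟩ := exists_discriminant_series
  have h1 := (HasQ.qParam_pow 1 1).mul (hasQ_E₄.pow 3)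
  have h2 := hφ.mul hD
  have h3 : (fun τ ↦ jInv τ * 𝕢 (1 : ℕ) τ) * discriminant =
      (fun τ : ℍ ↦ 𝕢 (1 : ℕ) τ ^ 1) * (E₄ : ℍ → ℂ) ^ 3 := by
    ext τ
    have := discriminant_ne_zero τ
    simp only [Pi.mul_apply, Pi.pow_apply, jInv]
    field_simp
  rw [h3] at h2
  have h4 := h2.unique one_ne_zero h1
  have hinv : D * PowerSeries.invOfUnit D 1 = 1 :=
    PowerSeries.mul_invOfUnit D 1 (by simpa using hD0)
  have h5 : φ = PowerSeries.map (Int.castRingHom ℂ)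
      ((1 + 240 * sigmaSeries 3) ^ 3 * PowerSeries.invOfUnit D 1) := by
    rw [map_mul, pow_one, PowerSeries.map_X, mul_left_comm] at h4
    have h6 := mul_left_cancel₀ PowerSeries.X_ne_zero h4
    rw [map_mul, map_pow, ← h6, mul_assoc, ← map_mul, hinv, map_one, mul_one]
  refine ⟨_, ?_, h5 ▸ hφ⟩
  rw [PowerSeries.coeff_zero_eq_constantCoeff_apply, map_mul, map_pow, map_add, map_mul,
    PowerSeries.constantCoeff_invOfUnit]
  simp [sigmaSeries, ← PowerSeries.coeff_zero_eq_constantCoeff_apply (PowerSeries.mk _)]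

lemma qParam_pow_self {N : ℕ} (hN : N ≠ 0) (τ : ℂ) : 𝕢 N τ ^ N = 𝕢 (1 : ℕ) τ := by
  rw [Periodic.qParam, Periodic.qParam, ← Complex.exp_nat_mul]
  congr 1
  push_cast
  field_simp

lemma qParam_ne_zero (N : ℕ) (τ : ℂ) : 𝕢 N τ ≠ 0 := Complex.exp_ne_zero _

lemma hasSum_congr' {u v : ℕ → ℂ} {a : ℂ} (h : ∀ n, u n = v n) : HasSum u a ↔ HasSum v a := by
  rw [funext h]

namespace HasQ

variable {N : ℕ} {φ ψ : PowerSeries ℂ} {f g : ℍ → ℂ}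

lemma of_X_mul (h : HasQ N (PowerSeries.X * φ) (fun τ ↦ 𝕢 N τ * f τ)) : HasQ N φ f := fun τ ↦ by
  have h1 := h τ
  rw [← hasSum_nat_add_iff' 1] at h1
  simp only [PowerSeries.coeff_succ_X_mul, Finset.range_one, Finset.sum_singleton,
    PowerSeries.coeff_zero_X_mul, zero_mul, sub_zero] at h1
  have h2 := h1.mul_left (𝕢 N τ)⁻¹
  have h3 := qParam_ne_zero N τ
  rw [inv_mul_cancel_left₀ h3] at h2
  exact (hasSum_congr' fun n ↦ by rw [pow_succ]; field_simp).mpr h2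

lemma congr (h : HasQ N φ f) (hφ : φ = ψ) (hf : ∀ τ, f τ = g τ) : HasQ N ψ g := by
  obtain rfl : f = g := funext hf
  exact hφ ▸ h

lemma rescale_vadd (h : HasQ N φ f) : HasQ N (PowerSeries.rescale (exp (2 * π * I / N)) φ)
    (fun τ ↦ f ((1 : ℝ) +ᵥ τ)) := fun τ ↦ by
  convert h ((1 : ℝ) +ᵥ τ) using 2 with n
  rw [qParam_vadd_one, PowerSeries.coeff_rescale]
  ring

lemma dvd_of_coeff_zero_ne_zero (hN : N ≠ 0) (hT : ∀ τ : ℍ, f ((1 : ℝ) +ᵥ τ) = f τ) {M : ℕ}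
    (h : HasQ N φ (fun τ ↦ f τ * 𝕢 N τ ^ M)) (h0 : φ.coeff 0 ≠ 0) : N ∣ M := by
  have h1 := h.rescale_vadd
  have h2 := (h.const_mul (exp (2 * π * I / N) ^ M)).congr (g := fun τ ↦ f ((1 : ℝ) +ᵥ τ) *
    𝕢 N ((1 : ℝ) +ᵥ τ : ℍ) ^ M) rfl fun τ ↦ by
      rw [hT, qParam_vadd_one]; ring
  have h3 := congrArg (PowerSeries.coeff 0) (h1.unique hN h2)
  rw [PowerSeries.coeff_rescale, PowerSeries.coeff_C_mul, pow_zero] at h3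
  have h4 := mul_right_cancel₀ h0 h3
  exact (Complex.isPrimitiveRoot_exp N hN).dvd_of_pow_eq_one M h4.symm

lemma lower (hN : N ≠ 0) (hT : ∀ τ : ℍ, f ((1 : ℝ) +ᵥ τ) = f τ) {K : ℕ}
    (h : HasQ N φ (fun τ ↦ f τ * 𝕢 N τ ^ (N * K))) :
    HasQ 1 (PowerSeries.mk fun n ↦ φ.coeff (N * n)) (fun τ ↦ f τ * 𝕢 (1 : ℕ) τ ^ K) := by
  have hprim := Complex.isPrimitiveRoot_exp N hN
  have h1 := h.rescale_vadd.congr (g := fun τ ↦ f τ * 𝕢 N τ ^ (N * K)) rfl fun τ ↦ by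
    rw [hT, qParam_vadd_one, mul_pow, pow_mul, hprim.pow_eq_one]; simp
  have h2 (n : ℕ) (hn : ¬ N ∣ n) : φ.coeff n = 0 := by
    have h3 := congrArg (PowerSeries.coeff n) (h1.unique hN h)
    rw [PowerSeries.coeff_rescale] at h3
    by_contra h0
    exact hn (hprim.dvd_of_pow_eq_one n (mul_right_cancel₀ h0 (h3.trans (one_mul _).symm)))
  intro τ
  have hinj : Injective (fun n : ℕ ↦ N * n) := mul_right_injective₀ hN
  have h4 := (hinj.hasSum_iff (f := fun n ↦ φ.coeff n * 𝕢 N τ ^ n) fun n hn ↦ ?_).mpr (h τ)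
  · convert h4 using 2 with n
    · simp [pow_mul, qParam_pow_self hN]
    · beta_reduce
      rw [pow_mul, qParam_pow_self hN]
  · rw [h2 n fun ⟨m, hm⟩ ↦ hn ⟨m, hm.symm⟩, zero_mul]

lemma shift {M : ℕ} (h : HasQ N φ (fun τ ↦ f τ * 𝕢 N τ ^ M)) (k : ℕ) :
    HasQ N (PowerSeries.X ^ k * φ) (fun τ ↦ f τ * 𝕢 N τ ^ (k + M)) :=
  ((qParam_pow N k).mul h).congr rfl fun τ ↦ by simp only [Pi.mul_apply]; ring

end HasQ

/-- Holomorphic functions on the upper half-plane whose Fourier expansion in `exp (2πiτ/N)` is a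
Laurent series with coefficients in `R`. -/
def laurentOver (R : Subring ℂ) (N : ℕ) : Subring (ℍ → ℂ) where
  carrier := {f | MDiff f ∧ ∃ M : ℕ, ∃ φ ∈ seriesOver R, HasQ N φ (fun τ ↦ f τ * 𝕢 N τ ^ M)}
  mul_mem' := by
    rintro f g ⟨hf, M, φ, hφ, h⟩ ⟨hg, M', φ', hφ', h'⟩
    exact ⟨hf.mul hg, M + M', φ * φ', mul_mem hφ hφ', (h.mul h').congr rfl fun τ ↦ by
      simp only [Pi.mul_apply]; ring⟩
  one_mem' := ⟨mdifferentiable_const, 0, 1, one_mem _, (HasQ.const N 1).congr (by simp) (by simp)⟩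
  add_mem' := by
    rintro f g ⟨hf, M, φ, hφ, h⟩ ⟨hg, M', φ', hφ', h'⟩
    have hX : (PowerSeries.X : PowerSeries ℂ) ∈ seriesOver R := ⟨PowerSeries.X, by simp⟩
    refine ⟨hf.add hg, M' + M, _, add_mem (mul_mem (pow_mem hX M') hφ) (mul_mem (pow_mem hX M) hφ'),
      ((h.shift M').add (h'.shift M)).congr rfl fun τ ↦ ?_⟩
    simp only [Pi.add_apply]; ring
  zero_mem' := ⟨mdifferentiable_const, 0, 0, zero_mem _, (HasQ.const N 0).congr (by simp) (by simp)⟩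
  neg_mem' := by
    rintro f ⟨hf, M, φ, hφ, h⟩
    exact ⟨hf.neg, M, -φ, neg_mem hφ, h.neg.congr rfl fun τ ↦ by simp⟩

lemma exists_const_of_invariant {f : ℍ → ℂ} (hinv : ∀ (γ : SL(2, ℤ)) τ, f (γ • τ) = f τ)
    (hf : MDiff f) (hb : IsBoundedAtImInfty f) : ∃ c, ∀ τ, f τ = c := by
  have hslash (γ : SL(2, ℤ)) : f ∣[(0 : ℤ)] γ = f := by
    ext τ
    simpa [SL_slash_apply] using! hinv γ τ
  let F : ModularForm 𝒮ℒ 0 :=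
    { toFun := f
      slash_action_eq' := by
        rintro _ ⟨γ, rfl⟩
        exact hslash γ
      holo' := hf
      bdd_at_cusps' := by
        intro c hc
        rw [Subgroup.IsArithmetic.isCusp_iff_isCusp_SL2Z] at hc
        rw [OnePoint.isBoundedAt_iff_forall_SL2Z hc]
        intro γ _
        rw [hslash]
        exact hb }
  obtain ⟨c, hc⟩ := ModularFormClass.levelOne_weight_zero_const F
  exact ⟨c, fun τ ↦ congrFun hc τ⟩

lemma exists_polynomial_of_hasQ {R : Subring ℂ} (M : ℕ) {f : ℍ → ℂ}
    (hinv : ∀ (γ : SL(2, ℤ)) τ, f (γ • τ) = f τ) (hf : MDiff f) {φ : PowerSeries ℂ}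
    (hφ : φ ∈ seriesOver R) (h : HasQ 1 φ (fun τ ↦ f τ * 𝕢 (1 : ℕ) τ ^ M)) :
    ∃ P : ℂ[X], P.natDegree ≤ M ∧ (∀ i, P.coeff i ∈ R) ∧ P.coeff M = φ.coeff 0 ∧
      ∀ τ, f τ = P.eval (jInv τ) := by
  induction M generalizing f φ with
  | zero =>
    simp only [pow_zero, mul_one] at h
    obtain ⟨c, hc⟩ := exists_const_of_invariant hinv hf
      (isBoundedAtImInfty_of_hasSum_qExpansion (h := (1 : ℕ)) (by simp)
        (c := fun n ↦ φ.coeff n) fun τ ↦ by simpa using h τ)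
    have h1 : φ = PowerSeries.C c :=
      h.unique one_ne_zero ((HasQ.const 1 c).congr rfl fun τ ↦ (hc τ).symm)
    have hcR : c ∈ R := by simpa [h1] using mem_seriesOver.mp hφ 0
    refine ⟨C c, by simp, fun i ↦ ?_, by simp [h1], by simpa using hc⟩
    rw [coeff_C]
    split_ifs
    exacts [hcR, zero_mem _]
  | succ M ih =>
    obtain ⟨J, hJ0, hJ⟩ := exists_jSeries
    have hJR : PowerSeries.map (Int.castRingHom ℂ) J ∈ seriesOver R :=
      mem_seriesOver.mpr fun n ↦ by simp
    have hcR := mem_seriesOver.mp hφ 0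
    set c := φ.coeff 0
    have hCR : PowerSeries.C c ∈ seriesOver R := ⟨PowerSeries.C ⟨c, hcR⟩, by simp⟩
    have h1 : HasQ 1 (φ - PowerSeries.C c * PowerSeries.map (Int.castRingHom ℂ) J ^ (M + 1))
        (fun τ ↦ 𝕢 (1 : ℕ) τ * ((f τ - c * jInv τ ^ (M + 1)) * 𝕢 (1 : ℕ) τ ^ M)) :=
      (h.sub ((hJ.pow (M + 1)).const_mul c)).congr rfl fun τ ↦ by
        simp only [Pi.sub_apply, Pi.pow_apply]; ring
    have h2 : PowerSeries.constantCoeff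
        (φ - PowerSeries.C c * PowerSeries.map (Int.castRingHom ℂ) J ^ (M + 1)) = 0 := by
      have : PowerSeries.constantCoeff (PowerSeries.map (Int.castRingHom ℂ) J) = 1 := by
        rw [← PowerSeries.coeff_zero_eq_constantCoeff_apply, PowerSeries.coeff_map, hJ0, map_one]
      rw [map_sub, map_mul, map_pow, this]
      simp [c]
    obtain ⟨ψ, hψ⟩ := PowerSeries.X_dvd_iff.mpr h2
    have hψR : ψ ∈ seriesOver R := mem_seriesOver.mpr fun n ↦ by
      rw [← PowerSeries.coeff_succ_X_mul, ← hψ]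
      exact mem_seriesOver.mp (sub_mem hφ (mul_mem hCR (pow_mem hJR _))) _
    rw [hψ] at h1
    obtain ⟨P, hP1, hP2, -, hP4⟩ := ih (f := fun τ ↦ f τ - c * jInv τ ^ (M + 1))
      (fun γ τ ↦ by rw [hinv, jInv_smul])
      (hf.sub (mdifferentiable_const.mul (mdifferentiable_jInv.pow _))) hψR h1.of_X_mul
    have hdeg : (C c * X ^ (M + 1)).natDegree ≤ M + 1 := natDegree_C_mul_X_pow_le _ _
    refine ⟨P + C c * X ^ (M + 1), natDegree_add_le_of_degree_le (by omega) hdeg, fun i ↦ ?_, ?_,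
      fun τ ↦ ?_⟩
    · rw [coeff_add, coeff_C_mul, coeff_X_pow]
      refine add_mem (hP2 i) ?_
      split_ifs <;> simp [hcR]
    · rw [coeff_add, coeff_eq_zero_of_natDegree_lt (by omega)]
      simp
    · have := hP4 τ
      simp only [eval_add, eval_mul, eval_C, eval_pow, eval_X]
      linear_combination this

lemma laurentOver_lower {R : Subring ℂ} {N : ℕ} (hN : N ≠ 0) {f : ℍ → ℂ}
    (hT : ∀ τ : ℍ, f ((1 : ℝ) +ᵥ τ) = f τ) (hf : f ∈ laurentOver R N) : f ∈ laurentOver R 1 := by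
  obtain ⟨hmd, M, φ, hφ, h⟩ := hf
  have h1 := h.shift ((N - 1) * M)
  have h2 : (N - 1) * M + M = N * M := by
    obtain ⟨n, rfl⟩ := Nat.exists_eq_succ_of_ne_zero hN
    simp; ring
  rw [h2] at h1
  have hX : (PowerSeries.X : PowerSeries ℂ) ∈ seriesOver R := ⟨PowerSeries.X, by simp⟩
  exact ⟨hmd, M, _, mem_seriesOver.mpr fun n ↦ by
    simpa only [PowerSeries.coeff_mk] using
      mem_seriesOver.mp (mul_mem (pow_mem hX ((N - 1) * M)) hφ) (N * n), h1.lower hN hT⟩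

lemma exists_polynomial_of_mem_laurentOver {R : Subring ℂ} {N : ℕ} (hN : N ≠ 0) {f : ℍ → ℂ}
    (hinv : ∀ (γ : SL(2, ℤ)) τ, f (γ • τ) = f τ) (hf : f ∈ laurentOver R N) :
    ∃ P : ℂ[X], (∀ i, P.coeff i ∈ R) ∧ ∀ τ, f τ = P.eval (jInv τ) := by
  obtain ⟨hmd, M, φ, hφ, h⟩ := laurentOver_lower hN
    (fun τ ↦ by rw [← modular_T_smul, hinv]) hf
  obtain ⟨P, -, h1, -, h2⟩ := exists_polynomial_of_hasQ M hinv hmd hφ h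
  exact ⟨P, h1, h2⟩

/-- If the leading Fourier coefficient of an invariant function does not vanish, it is also the
leading coefficient of the polynomial in `j` representing that function. -/
lemma exists_polynomial_of_coeff_ne_zero {R : Subring ℂ} {N : ℕ} (hN : N ≠ 0) {f : ℍ → ℂ}
    (hinv : ∀ (γ : SL(2, ℤ)) τ, f (γ • τ) = f τ) (hf : MDiff f) {φ : PowerSeries ℂ} {M : ℕ}
    (hφ : φ ∈ seriesOver R) (h : HasQ N φ (fun τ ↦ f τ * 𝕢 N τ ^ M)) (h0 : φ.coeff 0 ≠ 0) :
    ∃ P : ℂ[X], (∀ i, P.coeff i ∈ R) ∧ P.leadingCoeff = φ.coeff 0 ∧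
      ∀ τ, f τ = P.eval (jInv τ) := by
  have hT (τ : ℍ) : f ((1 : ℝ) +ᵥ τ) = f τ := by rw [← modular_T_smul, hinv]
  obtain ⟨K, rfl⟩ := h.dvd_of_coeff_zero_ne_zero hN hT h0
  obtain ⟨P, h1, h2, h3, h4⟩ := exists_polynomial_of_hasQ K hinv hf
    (mem_seriesOver.mpr fun n ↦ by
      simpa only [PowerSeries.coeff_mk] using mem_seriesOver.mp hφ (N * n)) (h.lower hN hT)
  simp only [PowerSeries.coeff_mk, mul_zero] at h3
  have h5 : P.natDegree = K := le_antisymm h1 (le_natDegree_of_ne_zero (h3 ▸ h0))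
  exact ⟨P, h2, by rw [leadingCoeff, h5, h3], h4⟩

/-- Index set `((a, d), b)` for the matrices `!![a, b; 0, d]` with `a d = m` and `0 ≤ b < d`. -/
def heckeIdx (m : ℕ) : Finset (Σ _ : ℕ × ℕ, ℕ) :=
  m.divisorsAntidiagonal.sigma fun p ↦ Finset.range p.2

def heckeMat (i : Σ _ : ℕ × ℕ, ℕ) : Matrix (Fin 2) (Fin 2) ℤ := !![(i.1.1 : ℤ), i.2; 0, i.1.2]

/-- The point `(a τ + b) / d`. -/
noncomputable def heckePt (i : Σ _ : ℕ × ℕ, ℕ) (τ : ℍ) : ℍ :=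
  ofComplex ((i.1.1 * (τ : ℂ) + i.2) / i.1.2)

section

variable {m : ℕ} {i : Σ _ : ℕ × ℕ, ℕ}

lemma mem_heckeIdx : i ∈ heckeIdx m ↔ (i.1.1 * i.1.2 = m ∧ m ≠ 0) ∧ i.2 < i.1.2 := by
  simp [heckeIdx]

lemma heckeIdx_pos (hi : i ∈ heckeIdx m) : 0 < i.1.1 ∧ 0 < i.1.2 := by
  obtain ⟨⟨h1, h2⟩, h3⟩ := mem_heckeIdx.mp hi
  exact ⟨Nat.pos_of_ne_zero fun h ↦ h2 (by rw [← h1, h, zero_mul]), by omega⟩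

lemma heckePt_aux (hi : i ∈ heckeIdx m) {τ : ℂ} (hτ : 0 < τ.im) :
    0 < ((i.1.1 * τ + i.2) / i.1.2 : ℂ).im := by
  obtain ⟨h1, h2⟩ := heckeIdx_pos hi
  have : ((i.1.1 * τ + i.2) / i.1.2 : ℂ).im = i.1.1 * τ.im / i.1.2 := by
    simp
  rw [this]
  positivity

lemma coe_heckePt (hi : i ∈ heckeIdx m) (τ : ℍ) :
    (heckePt i τ : ℂ) = (i.1.1 * (τ : ℂ) + i.2) / i.1.2 := by
  rw [heckePt, ofComplex_apply_of_im_pos (heckePt_aux hi τ.im_pos)]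

lemma mdifferentiable_comp_heckePt (hi : i ∈ heckeIdx m) {f : ℍ → ℂ} (hf : MDiff f) :
    MDiff (fun τ ↦ f (heckePt i τ)) := by
  rw [UpperHalfPlane.mdifferentiable_iff] at hf ⊢
  have h1 : DifferentiableOn ℂ (fun z : ℂ ↦ (i.1.1 * z + i.2) / i.1.2) {z | 0 < z.im} := by
    fun_prop
  refine (hf.comp h1 fun z hz ↦ heckePt_aux hi hz).congr fun z hz ↦ ?_
  simp only [comp_apply, heckePt, ofComplex_apply_of_im_pos (show 0 < z.im from hz)]

lemma det_heckeMat (hi : i ∈ heckeIdx m) : (heckeMat i).det = m := by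
  obtain ⟨⟨h1, h2⟩, h3⟩ := mem_heckeIdx.mp hi
  simp [heckeMat, ← h1]

lemma exists_heckeMat (hm : 0 < m) (M : Matrix (Fin 2) (Fin 2) ℤ) (hM : M.det = m) :
    ∃ i ∈ heckeIdx m, ∃ γ : SL(2, ℤ), (γ : Matrix (Fin 2) (Fin 2) ℤ) * heckeMat i = M := by
  let A : FixedDetMatrix (Fin 2) ℤ (m : ℤ) := ⟨M, hM⟩
  suffices ∀ A : FixedDetMatrix (Fin 2) ℤ (m : ℤ), ∃ i ∈ heckeIdx m, ∃ γ : SL(2, ℤ),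
    (γ : Matrix (Fin 2) (Fin 2) ℤ) * heckeMat i = A.1 from this A
  intro A
  have hm' : (m : ℤ) ≠ 0 := by exact_mod_cast hm.ne'
  refine FixedDetMatrices.induction_on (A := A) (C := fun A ↦ ∃ i ∈ heckeIdx m, ∃ γ : SL(2, ℤ),
    (γ : Matrix (Fin 2) (Fin 2) ℤ) * heckeMat i = A.1) hm' ?_ ?_ ?_
  · intro A h1 h2 h3 h4
    have h5 := A.2
    rw [Matrix.det_fin_two, h1, mul_zero, sub_zero] at h5
    have h6 : 0 < A.1 1 1 := pos_of_mul_pos_right (by rw [h5]; exact_mod_cast hm) h2.le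
    rw [abs_of_nonneg h3, abs_of_pos h6] at h4
    obtain ⟨a, ha⟩ := Int.eq_ofNat_of_zero_le h2.le
    obtain ⟨b, hb⟩ := Int.eq_ofNat_of_zero_le h3
    obtain ⟨d, hd⟩ := Int.eq_ofNat_of_zero_le h6.le
    refine ⟨⟨(a, d), b⟩, mem_heckeIdx.mpr ⟨⟨?_, hm.ne'⟩, ?_⟩, 1, ?_⟩
    · rw [ha, hd] at h5
      exact_mod_cast h5
    · rw [hb, hd] at h4
      exact_mod_cast h4
    · rw [Matrix.SpecialLinearGroup.coe_one, one_mul, heckeMat, Matrix.eta_fin_two A.1, ha, hb, hd,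
        h1]
  · rintro B ⟨i, hi, γ, h⟩
    exact ⟨i, hi, ModularGroup.S * γ, by
      rw [FixedDetMatrices.smul_coe, ← h, Matrix.SpecialLinearGroup.coe_mul, mul_assoc]⟩
  · rintro B ⟨i, hi, γ, h⟩
    exact ⟨i, hi, ModularGroup.T * γ, by
      rw [FixedDetMatrices.smul_coe, ← h, Matrix.SpecialLinearGroup.coe_mul, mul_assoc]⟩

lemma heckeMat_unique {i j : Σ _ : ℕ × ℕ, ℕ} (hi : i ∈ heckeIdx m) (hj : j ∈ heckeIdx m)
    {γ : SL(2, ℤ)} (h : (γ : Matrix (Fin 2) (Fin 2) ℤ) * heckeMat i = heckeMat j) : i = j := by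
  obtain ⟨⟨-, -⟩, hi3⟩ := mem_heckeIdx.mp hi
  obtain ⟨⟨-, -⟩, hj3⟩ := mem_heckeIdx.mp hj
  obtain ⟨hi1, hi2⟩ := heckeIdx_pos hi
  obtain ⟨hj1, hj2⟩ := heckeIdx_pos hj
  obtain ⟨⟨a, d⟩, b⟩ := i
  obtain ⟨⟨a', d'⟩, b'⟩ := j
  dsimp only at *
  have hdet := γ.det_coe
  rw [Matrix.det_fin_two] at hdet
  rw [heckeMat, heckeMat, Matrix.eta_fin_two (γ : Matrix (Fin 2) (Fin 2) ℤ)] at h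
  have h00 := congrFun (congrFun h 0) 0
  have h01 := congrFun (congrFun h 0) 1
  have h10 := congrFun (congrFun h 1) 0
  have h11 := congrFun (congrFun h 1) 1
  simp only [Matrix.mul_fin_two, Matrix.of_apply, Matrix.cons_val_zero, Matrix.cons_val_one,
    Matrix.cons_val', Matrix.cons_val_fin_one, mul_zero, add_zero] at h00 h01 h10 h11
  have hc : γ 1 0 = 0 := by
    rcases mul_eq_zero.mp h10 with h | h
    · exact h
    · omega
  rw [hc, mul_zero, sub_zero] at hdet
  rw [hc, zero_mul, zero_add] at h11
  have hp : 0 < γ 0 0 :=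
    pos_of_mul_pos_left (b := (a : ℤ)) (by rw [h00]; exact_mod_cast hj1) (by positivity)
  have hp1 : γ 0 0 = 1 := by
    rcases Int.eq_one_or_neg_one_of_mul_eq_one hdet with h | h <;> omega
  rw [hp1, one_mul] at hdet h00 h01
  rw [hdet, one_mul] at h11
  have hd : d = d' := by exact_mod_cast h11
  have ha : a = a' := by exact_mod_cast h00
  subst hd ha
  have hb : b = b' := by
    have h1 : (b' : ℤ) % d = b % d := by rw [← h01]; simp
    rw [Int.emod_eq_of_lt (by positivity) (by exact_mod_cast hj3),
      Int.emod_eq_of_lt (by positivity) (by exact_mod_cast hi3)] at h1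
    exact_mod_cast h1.symm
  rw [hb]

lemma coe_smul_heckePt (hi : i ∈ heckeIdx m) {γ : SL(2, ℤ)} {M : Matrix (Fin 2) (Fin 2) ℤ}
    (h : (γ : Matrix (Fin 2) (Fin 2) ℤ) * heckeMat i = M) (τ : ℍ) :
    ((γ • heckePt i τ : ℍ) : ℂ) = (M 0 0 * τ + M 0 1) / (M 1 0 * τ + M 1 1) := by
  subst h
  have h2 : (i.1.2 : ℂ) ≠ 0 := by exact_mod_cast (heckeIdx_pos hi).2.ne'
  rw [coe_specialLinearGroup_apply, coe_heckePt hi, heckeMat,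
    Matrix.eta_fin_two (γ : Matrix (Fin 2) (Fin 2) ℤ)]
  simp only [Matrix.mul_fin_two, Matrix.of_apply, Matrix.cons_val_zero, Matrix.cons_val_one,
    Matrix.cons_val', Matrix.cons_val_fin_one, mul_zero, add_zero]
  rw [← mul_div_mul_right _ _ h2]
  congr 1 <;> push_cast <;> simp <;> field_simp <;> ring

lemma exists_heckePt_smul (g : SL(2, ℤ)) (hi : i ∈ heckeIdx m) :
    ∃ j ∈ heckeIdx m, ∃ γ : SL(2, ℤ),
      (γ : Matrix (Fin 2) (Fin 2) ℤ) * heckeMat j = heckeMat i * g := by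
  obtain ⟨⟨h1, h2⟩, h3⟩ := mem_heckeIdx.mp hi
  exact exists_heckeMat (Nat.pos_of_ne_zero h2) _ (by rw [Matrix.det_mul, det_heckeMat hi]; simp)

lemma heckePt_smul {i j : Σ _ : ℕ × ℕ, ℕ} {g γ : SL(2, ℤ)} (hi : i ∈ heckeIdx m)
    (hj : j ∈ heckeIdx m)
    (h : (γ : Matrix (Fin 2) (Fin 2) ℤ) * heckeMat j = heckeMat i * g) (τ : ℍ) :
    heckePt i (g • τ) = γ • heckePt j τ := by
  apply UpperHalfPlane.ext
  have hne := denom_ne_zero g τ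
  have h2 : (i.1.2 : ℂ) ≠ 0 := by exact_mod_cast (heckeIdx_pos hi).2.ne'
  have hne' : (g 1 0 : ℂ) * τ + g 1 1 ≠ 0 := by simpa [denom] using hne
  rw [coe_smul_heckePt hj h, coe_heckePt hi, coe_specialLinearGroup_apply, heckeMat,
    Matrix.eta_fin_two (g : Matrix (Fin 2) (Fin 2) ℤ)]
  simp only [Matrix.mul_fin_two, Matrix.of_apply, Matrix.cons_val_zero, Matrix.cons_val_one,
    Matrix.cons_val', Matrix.cons_val_fin_one, zero_mul, zero_add]
  push_cast
  simp only [algebraMap_int_eq, eq_intCast, ofReal_intCast]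
  rw [div_eq_div_iff h2]
  · rw [mul_div_assoc', div_add' _ _ _ hne', div_mul_eq_mul_div, div_eq_iff hne']
    ring
  · intro h
    apply hne'
    apply mul_left_cancel₀ h2
    linear_combination h

end

lemma map_heckePt_smul {α : Type*} (m : ℕ) {F : ℍ → α} (hF : ∀ (γ : SL(2, ℤ)) τ, F (γ • τ) = F τ)
    (g : SL(2, ℤ)) (τ : ℍ) :
    (heckeIdx m).val.map (fun i ↦ F (heckePt i (g • τ))) =
      (heckeIdx m).val.map (fun i ↦ F (heckePt i τ)) := by
  choose! σ hσ γ hγ using fun i (hi : i ∈ heckeIdx m) ↦ exists_heckePt_smul g hi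
  have hinj : Set.InjOn σ (heckeIdx m) := fun i hi j hj hij ↦ by
    have h1 := hγ i hi
    have h2 := hγ j hj
    rw [hij] at h1
    apply heckeMat_unique hi hj (γ := γ j * (γ i)⁻¹)
    have h3 : heckeMat i =
        (γ i : Matrix (Fin 2) (Fin 2) ℤ) * heckeMat (σ j) * (g⁻¹ : SL(2, ℤ)) := by
      rw [h1, mul_assoc, ← Matrix.SpecialLinearGroup.coe_mul]; simp
    have h4 : heckeMat j =
        (γ j : Matrix (Fin 2) (Fin 2) ℤ) * heckeMat (σ j) * (g⁻¹ : SL(2, ℤ)) := by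
      rw [h2, mul_assoc, ← Matrix.SpecialLinearGroup.coe_mul]; simp
    rw [h3, h4, ← mul_assoc, ← mul_assoc, ← Matrix.SpecialLinearGroup.coe_mul, mul_assoc (γ j),
      inv_mul_cancel, mul_one]
  have himg : (heckeIdx m).image σ = heckeIdx m :=
    Finset.eq_of_subset_of_card_le (Finset.image_subset_iff.mpr hσ)
      (Finset.card_image_of_injOn hinj).ge
  have h5 : (heckeIdx m).val.map σ = (heckeIdx m).val := by
    conv_rhs => rw [← himg]
    rw [Finset.image_val_of_injOn hinj]
  conv_rhs => rw [← h5, Multiset.map_map]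
  exact Multiset.map_congr rfl fun i hi ↦ by
    rw [heckePt_smul hi (hσ i hi) (hγ i hi), hF]; rfl

lemma qParam_heckePt {m : ℕ} {i : Σ _ : ℕ × ℕ, ℕ} (hi : i ∈ heckeIdx m) (τ : ℍ) :
    𝕢 (1 : ℕ) (heckePt i τ) = exp (2 * π * I / i.1.2) ^ i.2 * 𝕢 m τ ^ (i.1.1 ^ 2) := by
  obtain ⟨⟨h1, h2⟩, h3⟩ := mem_heckeIdx.mp hi
  have h4 : (i.1.2 : ℂ) ≠ 0 := by exact_mod_cast (heckeIdx_pos hi).2.ne'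
  have h5 : (i.1.1 : ℂ) ≠ 0 := by exact_mod_cast (heckeIdx_pos hi).1.ne'
  rw [Periodic.qParam, Periodic.qParam, ← Complex.exp_nat_mul, ← Complex.exp_nat_mul,
    ← Complex.exp_add, coe_heckePt hi, ← h1]
  congr 1
  push_cast
  field_simp
  ring

lemma HasQ.comp_heckePt {m : ℕ} {i : Σ _ : ℕ × ℕ, ℕ} (hi : i ∈ heckeIdx m) {φ : PowerSeries ℂ}
    {f : ℍ → ℂ} (h : HasQ 1 φ f) :
    HasQ m (PowerSeries.expand (i.1.1 ^ 2) (pow_ne_zero 2 (heckeIdx_pos hi).1.ne')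
      (PowerSeries.rescale (exp (2 * π * I / i.1.2) ^ i.2) φ)) (fun τ ↦ f (heckePt i τ)) := by
  intro τ
  have hpos : i.1.1 ^ 2 ≠ 0 := pow_ne_zero 2 (heckeIdx_pos hi).1.ne'
  have hinj : Injective (fun n : ℕ ↦ i.1.1 ^ 2 * n) := mul_right_injective₀ hpos
  refine (hinj.hasSum_iff fun n hn ↦ ?_).mp ((hasSum_congr' fun n ↦ ?_).mpr (h (heckePt i τ)))
  · rw [PowerSeries.coeff_expand_of_not_dvd _ _ _ fun ⟨k, hk⟩ ↦ hn ⟨k, hk.symm⟩, zero_mul]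
  · rw [comp_apply, PowerSeries.coeff_expand_mul, PowerSeries.coeff_rescale, qParam_heckePt hi,
      mul_pow, ← pow_mul (𝕢 _ _)]
    ring

/-- The ring of algebraic integers in `ℂ`. -/
def algInt : Subring ℂ := (integralClosure ℤ ℂ).toSubring

lemma intSubring_le_algInt : intSubring ≤ algInt := by
  rintro _ ⟨n, rfl⟩
  exact isIntegral_algebraMap (R := ℤ) (x := n)

lemma laurentOver_mono {R S : Subring ℂ} (h : R ≤ S) (N : ℕ) : laurentOver R N ≤ laurentOver S N :=
  fun _ ⟨hf, M, φ, hφ, h'⟩ ↦ ⟨hf, M, φ, seriesOver_mono h hφ, h'⟩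

lemma isIntegral_of_eval_eq_zero {P : ℂ[X]} (hP : ∀ k, P.coeff k ∈ algInt)
    (hu : P.leadingCoeff⁻¹ ∈ algInt) (h0 : P ≠ 0) {z : ℂ} (hz : P.eval z = 0) : IsIntegral ℤ z := by
  obtain ⟨P', hP'⟩ : ∃ P', P' = C P.leadingCoeff⁻¹ * P := ⟨_, rfl⟩
  have h1 : ∀ k, P'.coeff k ∈ algInt := fun k ↦ by
    rw [hP', coeff_C_mul]; exact mul_mem hu (hP k)
  have h2 : P'.Monic := by
    rw [hP', Monic, leadingCoeff_mul, leadingCoeff_C, inv_mul_cancel₀ (leadingCoeff_ne_zero.mpr h0)]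
  obtain ⟨Q, hQ, -, hQm⟩ := lifts_and_natDegree_eq_and_monic
    (f := algebraMap (integralClosure ℤ ℂ) ℂ)
    ((lifts_iff_coeff_lifts _).mpr fun k ↦ ⟨⟨_, h1 k⟩, rfl⟩) h2
  have h3 : IsIntegral (integralClosure ℤ ℂ) z :=
    ⟨Q, hQm, by rw [← eval_map, hQ, hP', eval_mul, hz, mul_zero]⟩
  exact isIntegral_trans z h3

lemma isIntegral_eval {P : ℂ[X]} (hP : ∀ k, P.coeff k ∈ algInt) {z : ℂ} (hz : IsIntegral ℤ z) :
    IsIntegral ℤ (P.eval z) := by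
  rw [eval_eq_sum_range]
  exact IsIntegral.sum _ fun k _ ↦ (hP k).mul (hz.pow k)

/-- If a finite family of modular functions with algebraic integer Fourier coefficients is
permuted by `SL(2, ℤ)`, then its values are integral where `j` is. -/
lemma isIntegral_of_permuted {ι : Type*} (s : Finset ι) {N : ℕ} (hN : N ≠ 0) {f : ι → ℍ → ℂ}
    (hf : ∀ i ∈ s, f i ∈ laurentOver algInt N)
    (hinv : ∀ (γ : SL(2, ℤ)) τ, s.val.map (fun i ↦ f i (γ • τ)) = s.val.map (fun i ↦ f i τ))
    {τ : ℍ} (hτ : IsIntegral ℤ (jInv τ)) {i : ι} (hi : i ∈ s) : IsIntegral ℤ (f i τ) := by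
  let F : (laurentOver algInt N)[X] := ∏ i ∈ s.attach, (X - C ⟨f i.1, hf i.1 i.2⟩)
  let ev (τ : ℍ) : laurentOver algInt N →+* ℂ :=
    (Pi.evalRingHom (fun _ ↦ ℂ) τ).comp (laurentOver algInt N).subtype
  have hF (τ : ℍ) : F.map (ev τ) = ∏ i ∈ s, (X - C (f i τ)) := by
    rw [← Finset.prod_attach, Polynomial.map_prod]
    refine Finset.prod_congr rfl fun i _ ↦ ?_
    simp [ev]
  have hFinv (γ : SL(2, ℤ)) (τ : ℍ) : F.map (ev (γ • τ)) = F.map (ev τ) := by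
    rw [hF, hF]
    have := congrArg (fun t ↦ (t.map fun x : ℂ ↦ X - C x).prod) (hinv γ τ)
    simp only [Multiset.map_map] at this
    exact this
  have hcoeff (k : ℕ) : IsIntegral ℤ ((F.map (ev τ)).coeff k) := by
    obtain ⟨P, hP, hPF⟩ := exists_polynomial_of_mem_laurentOver hN (f := (F.coeff k : ℍ → ℂ))
      (fun γ τ ↦ by simpa [ev] using congrArg (fun p ↦ p.coeff k) (hFinv γ τ)) (F.coeff k).2
    have h1 : (F.map (ev τ)).coeff k = P.eval (jInv τ) := by rw [← hPF]; simp [ev]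
    rw [h1]
    exact isIntegral_eval hP hτ
  have hmonic : (F.map (ev τ)).Monic := by
    rw [hF]; exact monic_prod_of_monic _ _ fun i _ ↦ monic_X_sub_C _
  refine isIntegral_of_eval_eq_zero hcoeff ?_ hmonic.ne_zero (z := f i τ) ?_
  · rw [hmonic.leadingCoeff, inv_one]; exact one_mem _
  · rw [hF, eval_prod]
    exact Finset.prod_eq_zero hi (by simp)

lemma mul_esymm_mem {A σ : Type*} [CommRing A] [Algebra ℚ A] [Fintype σ] (B : Subalgebra ℚ A)
    (x : σ → A) (hx : ∀ k, ∑ i, x i ^ k ∈ B) (k : ℕ) :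
    MvPolynomial.aeval x (MvPolynomial.esymm σ ℚ k) ∈ B := by
  induction k using Nat.strong_induction_on with
  | _ k ih =>
    rcases Nat.eq_zero_or_pos k with rfl | hk
    · simp
    have h := congrArg (MvPolynomial.aeval x) (MvPolynomial.mul_esymm_eq_sum σ ℚ k)
    simp only [map_mul, map_sum, map_pow, map_neg, map_one, map_natCast, MvPolynomial.psum,
      MvPolynomial.aeval_X] at h
    have h1 : (k : A) * MvPolynomial.aeval x (MvPolynomial.esymm σ ℚ k) ∈ B := by
      rw [h]
      refine mul_mem (pow_mem (neg_mem (one_mem _)) _) (sum_mem fun a ha ↦ ?_)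
      exact mul_mem (mul_mem (pow_mem (neg_mem (one_mem _)) _)
        (ih _ (Finset.mem_filter.mp ha).2)) (hx _)
    have h2 := B.smul_mem h1 (k : ℚ)⁻¹
    have hk' : (k : ℚ) ≠ 0 := by exact_mod_cast hk.ne'
    rwa [← nsmul_eq_mul, ← Nat.cast_smul_eq_nsmul ℚ, smul_smul, inv_mul_cancel₀ hk', one_smul] at h2

lemma prod_sub_mem {A σ : Type*} [CommRing A] [Algebra ℚ A] (s : Finset σ) (B : Subalgebra ℚ A)
    (x : σ → A) (hx : ∀ k, ∑ i ∈ s, x i ^ k ∈ B) {y : A} (hy : y ∈ B) :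
    ∏ i ∈ s, (y - x i) ∈ B := by
  have h1 := mul_esymm_mem B (fun i : s ↦ x i) fun k ↦ by
    rw [Finset.sum_coe_sort s (fun i ↦ x i ^ k)]; exact hx k
  have h2 := congrArg (Polynomial.eval y) (Multiset.prod_X_sub_X_eq_sum_esymm (s.val.map x))
  have h3 : ∏ i ∈ s, (y - x i) =
      Polynomial.eval y ((s.val.map x).map fun t ↦ X - C t).prod := by
    rw [Multiset.map_map, ← coe_evalRingHom, map_multiset_prod, Multiset.map_map]
    exact Finset.prod_congr rfl fun i _ ↦ by simp
  rw [h3, h2, eval_finsetSum]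
  refine sum_mem fun k _ ↦ ?_
  simp only [eval_mul, eval_pow, eval_neg, eval_one, eval_C, eval_X]
  refine mul_mem (pow_mem (neg_mem (one_mem _)) _) (mul_mem ?_ (pow_mem hy _))
  have h4 := h1 k
  rw [MvPolynomial.aeval_esymm_eq_multiset_esymm] at h4
  convert h4 using 2
  have : (Finset.univ : Finset s).val.map (fun i : s ↦ x i) = s.val.map x := by
    rw [Finset.univ_eq_attach, Finset.attach_val]
    exact Multiset.attach_map_val' _ _
  exact this.symm

lemma HasQ.raise {φ : PowerSeries ℂ} {f : ℍ → ℂ} (h : HasQ 1 φ f) {m : ℕ} (hm : m ≠ 0) :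
    HasQ m (PowerSeries.expand m hm φ) f := fun τ ↦ by
  have hinj : Injective (fun n : ℕ ↦ m * n) := mul_right_injective₀ hm
  refine (hinj.hasSum_iff fun n hn ↦ ?_).mp ((hasSum_congr' fun n ↦ ?_).mpr (h τ))
  · rw [PowerSeries.coeff_expand_of_not_dvd _ _ _ fun ⟨k, hk⟩ ↦ hn ⟨k, hk.symm⟩, zero_mul]
  · rw [comp_apply, PowerSeries.coeff_expand_mul, pow_mul, qParam_pow_self hm]

lemma expand_mem_seriesOver {R : Subring ℂ} {φ : PowerSeries ℂ} (h : φ ∈ seriesOver R) {m : ℕ}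
    (hm : m ≠ 0) : PowerSeries.expand m hm φ ∈ seriesOver R := mem_seriesOver.mpr fun n ↦ by
  rw [PowerSeries.coeff_expand]
  split_ifs
  exacts [mem_seriesOver.mp h _, zero_mem _]

lemma laurentOver_raise {R : Subring ℂ} {f : ℍ → ℂ} (hf : f ∈ laurentOver R 1) {m : ℕ}
    (hm : m ≠ 0) : f ∈ laurentOver R m := by
  obtain ⟨hmd, M, φ, hφ, h⟩ := hf
  exact ⟨hmd, m * M, _, expand_mem_seriesOver hφ hm, (h.raise hm).congr rfl fun τ ↦ by
    rw [pow_mul, qParam_pow_self hm]⟩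

lemma exp_mem_algInt {d : ℕ} (hd : d ≠ 0) : exp (2 * π * I / d) ∈ algInt :=
  (Complex.isPrimitiveRoot_exp d hd).isIntegral (Nat.pos_of_ne_zero hd)

lemma exp_inv_mem_algInt {d : ℕ} (hd : d ≠ 0) : (exp (2 * π * I / d))⁻¹ ∈ algInt :=
  (Complex.isPrimitiveRoot_exp d hd).inv.isIntegral (Nat.pos_of_ne_zero hd)

section

variable {m : ℕ} {i : Σ _ : ℕ × ℕ, ℕ}

lemma HasQ.comp_heckePt_mul (hi : i ∈ heckeIdx m) {φ : PowerSeries ℂ} {f : ℍ → ℂ} {M : ℕ}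
    (h : HasQ 1 φ (fun τ ↦ f τ * 𝕢 (1 : ℕ) τ ^ M)) :
    HasQ m (PowerSeries.C ((exp (2 * π * I / i.1.2))⁻¹ ^ (i.2 * M)) *
      PowerSeries.expand (i.1.1 ^ 2) (pow_ne_zero 2 (heckeIdx_pos hi).1.ne')
      (PowerSeries.rescale (exp (2 * π * I / i.1.2) ^ i.2) φ))
      (fun τ ↦ f (heckePt i τ) * 𝕢 m τ ^ (i.1.1 ^ 2 * M)) :=
  ((h.comp_heckePt hi).const_mul _).congr rfl fun τ ↦ by
    have hne : exp (2 * π * I / i.1.2) ≠ 0 := Complex.exp_ne_zero _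
    rw [qParam_heckePt hi, inv_pow, mul_pow, ← pow_mul, ← pow_mul]
    field_simp

lemma rescale_mem_seriesOver {R : Subring ℂ} {φ : PowerSeries ℂ} (h : φ ∈ seriesOver R) {c : ℂ}
    (hc : c ∈ R) : PowerSeries.rescale c φ ∈ seriesOver R := mem_seriesOver.mpr fun n ↦ by
  rw [PowerSeries.coeff_rescale]
  exact mul_mem (pow_mem hc n) (mem_seriesOver.mp h n)

lemma C_mem_seriesOver {R : Subring ℂ} {c : ℂ} (hc : c ∈ R) : PowerSeries.C c ∈ seriesOver R :=
  ⟨PowerSeries.C ⟨c, hc⟩, by simp⟩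

lemma comp_heckePt_series_mem (hi : i ∈ heckeIdx m) {φ : PowerSeries ℂ} (hφ : φ ∈ seriesOver algInt)
    (M : ℕ) : PowerSeries.C ((exp (2 * π * I / i.1.2))⁻¹ ^ (i.2 * M)) *
      PowerSeries.expand (i.1.1 ^ 2) (pow_ne_zero 2 (heckeIdx_pos hi).1.ne')
      (PowerSeries.rescale (exp (2 * π * I / i.1.2) ^ i.2) φ) ∈ seriesOver algInt :=
  mul_mem (C_mem_seriesOver (pow_mem (exp_inv_mem_algInt (heckeIdx_pos hi).2.ne') _))
    (expand_mem_seriesOver (rescale_mem_seriesOver hφ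
      (pow_mem (exp_mem_algInt (heckeIdx_pos hi).2.ne') _)) _)

lemma comp_heckePt_mem_laurentOver (hi : i ∈ heckeIdx m) {f : ℍ → ℂ}
    (hf : f ∈ laurentOver algInt 1) :
    (fun τ ↦ f (heckePt i τ)) ∈ laurentOver algInt m := by
  obtain ⟨hmd, M, φ, hφ, h⟩ := hf
  exact ⟨mdifferentiable_comp_heckePt hi hmd, _, _, comp_heckePt_series_mem hi hφ M,
    h.comp_heckePt_mul hi⟩

lemma jInv_mem_laurentOver : jInv ∈ laurentOver intSubring 1 := by
  obtain ⟨J, -, hJ⟩ := exists_jSeries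
  exact ⟨mdifferentiable_jInv, 1, _, map_int_mem_seriesOver J, by simpa using hJ⟩

lemma sum_pow_jInv_heckePt_mem (m r : ℕ) (p : ℕ × ℕ) (hp : p ∈ m.divisorsAntidiagonal) :
    (fun τ ↦ ∑ b ∈ Finset.range p.2, jInv (heckePt ⟨p, b⟩ τ) ^ r) ∈ laurentOver intSubring m := by
  obtain ⟨J, -, hJ⟩ := exists_jSeries
  have hJr : HasQ 1 (PowerSeries.map (Int.castRingHom ℂ) (J ^ r))
      (fun τ ↦ jInv τ ^ r * 𝕢 (1 : ℕ) τ ^ r) :=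
    (hJ.pow r).congr (by simp) fun τ ↦ by simp [mul_pow]
  have hmem (b : ℕ) (hb : b ∈ Finset.range p.2) : (⟨p, b⟩ : Σ _ : ℕ × ℕ, ℕ) ∈ heckeIdx m :=
    Finset.mem_sigma.mpr ⟨hp, hb⟩
  rcases Nat.eq_zero_or_pos p.2 with h0 | h0
  · simp only [h0, Finset.range_zero, Finset.sum_empty]
    exact zero_mem _
  have hp1 : p.1 ^ 2 ≠ 0 :=
    pow_ne_zero 2 (heckeIdx_pos (hmem 0 (Finset.mem_range.mpr h0))).1.ne'
  set ζ := exp (2 * π * I / p.2) with hζ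
  have hprim : IsPrimitiveRoot ζ p.2 := Complex.isPrimitiveRoot_exp _ h0.ne'
  refine ⟨?_, p.1 ^ 2 * r, ∑ b ∈ Finset.range p.2, PowerSeries.C (ζ⁻¹ ^ (b * r)) *
      PowerSeries.expand (p.1 ^ 2) hp1 (PowerSeries.rescale (ζ ^ b)
        (PowerSeries.map (Int.castRingHom ℂ) (J ^ r))), ?_, ?_⟩
  · have : MDiff (∑ b ∈ Finset.range p.2, fun τ ↦ jInv (heckePt ⟨p, b⟩ τ) ^ r) :=
      MDifferentiable.sum fun b hb ↦
        (mdifferentiable_comp_heckePt (hmem b hb) mdifferentiable_jInv).pow r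
    convert this using 1
    ext τ
    simp
  · rw [mem_seriesOver]
    intro n
    simp only [map_sum, PowerSeries.coeff_C_mul, PowerSeries.coeff_expand]
    split_ifs with hn
    · simp only [PowerSeries.coeff_rescale, PowerSeries.coeff_map]
      set k := n / p.1 ^ 2
      have h1 (b : ℕ) : ζ⁻¹ ^ (b * r) * ((ζ ^ b) ^ k * (Int.castRingHom ℂ) ((J ^ r).coeff k)) =
          (ζ⁻¹ ^ r * ζ ^ k) ^ b * (Int.castRingHom ℂ) ((J ^ r).coeff k) := by
        rw [mul_pow, ← pow_mul, ← pow_mul, ← pow_mul, mul_comm r b, mul_comm k b, mul_assoc]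
      simp only [h1, ← Finset.sum_mul]
      refine mul_mem ?_ ⟨_, rfl⟩
      by_cases hw : ζ⁻¹ ^ r * ζ ^ k = 1
      · simp only [hw, one_pow, Finset.sum_const, Finset.card_range, nsmul_eq_mul, mul_one]
        exact natCast_mem _ _
      · rw [geom_sum_eq hw, mul_pow, ← pow_mul, ← pow_mul, mul_comm r, mul_comm k, pow_mul, pow_mul,
          inv_pow, hprim.pow_eq_one]
        simp
    · simp
  · have h1 (b : ℕ) (hb : b ∈ Finset.range p.2) :
        HasQ m (PowerSeries.C (ζ⁻¹ ^ (b * r)) * PowerSeries.expand (p.1 ^ 2) hp1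
          (PowerSeries.rescale (ζ ^ b) (PowerSeries.map (Int.castRingHom ℂ) (J ^ r))))
          (fun τ ↦ jInv (heckePt ⟨p, b⟩ τ) ^ r * 𝕢 m τ ^ (p.1 ^ 2 * r)) :=
      HasQ.comp_heckePt_mul (i := ⟨p, b⟩) (f := fun τ ↦ jInv τ ^ r) (hmem b hb) hJr
    refine (HasQ.sum (Finset.range p.2) h1).congr rfl fun τ ↦ ?_
    simp [Finset.sum_mul]

end

lemma coeff_zero_mul_eq (φ ψ : PowerSeries ℂ) :
    (φ * ψ).coeff 0 = φ.coeff 0 * ψ.coeff 0 := by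
  simp only [PowerSeries.coeff_zero_eq_constantCoeff_apply, map_mul]

/-- The Fourier expansion of `f` has algebraic integer coefficients and its leading coefficient is
a unit. -/
def HasUnitLead (N : ℕ) (f : ℍ → ℂ) : Prop :=
  ∃ M : ℕ, ∃ φ ∈ seriesOver algInt, HasQ N φ (fun τ ↦ f τ * 𝕢 N τ ^ M) ∧ φ.coeff 0 ≠ 0 ∧
    (φ.coeff 0)⁻¹ ∈ algInt

lemma HasUnitLead.prod {ι : Type*} {s : Finset ι} {N : ℕ} {f : ι → ℍ → ℂ}
    (h : ∀ i ∈ s, HasUnitLead N (f i)) : HasUnitLead N (fun τ ↦ ∏ i ∈ s, f i τ) := by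
  classical
  induction s using Finset.induction_on with
  | empty =>
    exact ⟨0, 1, one_mem _, (HasQ.const N 1).congr (by simp) (by simp), by simp,
      by simp⟩
  | insert i s hi ih =>
    obtain ⟨M, φ, h1, h2, h3, h4⟩ := h i (Finset.mem_insert_self i s)
    obtain ⟨M', φ', h1', h2', h3', h4'⟩ := ih fun j hj ↦ h j (Finset.mem_insert_of_mem hj)
    refine ⟨M + M', φ * φ', mul_mem h1 h1', (h2.mul h2').congr rfl fun τ ↦ ?_, ?_, ?_⟩
    · simp only [Pi.mul_apply, Finset.prod_insert hi]; ring
    · rw [coeff_zero_mul_eq]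
      exact mul_ne_zero h3 h3'
    · rw [coeff_zero_mul_eq, mul_inv]
      exact mul_mem h4 h4'

lemma hasUnitLead_sub {m : ℕ} (hsq : ¬ IsSquare m) {i : Σ _ : ℕ × ℕ, ℕ} (hi : i ∈ heckeIdx m) :
    HasUnitLead m (fun τ ↦ jInv τ - jInv (heckePt i τ)) := by
  obtain ⟨⟨hm, hm0⟩, -⟩ := mem_heckeIdx.mp hi
  obtain ⟨J, hJ0, hJ⟩ := exists_jSeries
  set j := PowerSeries.map (Int.castRingHom ℂ) J
  have hJ1 : HasQ 1 j (fun τ ↦ jInv τ * 𝕢 (1 : ℕ) τ ^ 1) := by simpa using hJ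
  have hj : j ∈ seriesOver algInt :=
    seriesOver_mono intSubring_le_algInt (map_int_mem_seriesOver J)
  have hj0 : j.coeff 0 = 1 := by rw [PowerSeries.coeff_map, hJ0, map_one]
  have hX : (PowerSeries.X : PowerSeries ℂ) ∈ seriesOver algInt := ⟨PowerSeries.X, by simp⟩
  have h1 : HasQ m (PowerSeries.expand m hm0 j) (fun τ ↦ jInv τ * 𝕢 m τ ^ m) :=
    (hJ1.raise hm0).congr rfl fun τ ↦ by rw [pow_one, qParam_pow_self hm0]
  have h2 := hJ1.comp_heckePt_mul hi
  have h2m := comp_heckePt_series_mem hi hj 1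
  set ζ := exp (2 * π * I / i.1.2) with hζ
  set ψ := PowerSeries.C (ζ⁻¹ ^ (i.2 * 1)) * PowerSeries.expand (i.1.1 ^ 2)
    (pow_ne_zero 2 (heckeIdx_pos hi).1.ne') (PowerSeries.rescale (ζ ^ i.2) j) with hψ
  have hψ0 : ψ.coeff 0 = ζ⁻¹ ^ i.2 := by
    rw [hψ, PowerSeries.coeff_C_mul, PowerSeries.coeff_zero_eq_constantCoeff_apply,
      PowerSeries.constantCoeff_expand, ← PowerSeries.coeff_zero_eq_constantCoeff_apply,
      PowerSeries.coeff_rescale, hj0]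
    simp
  have h10 : (PowerSeries.expand m hm0 j).coeff 0 = 1 := by
    rw [PowerSeries.coeff_zero_eq_constantCoeff_apply, PowerSeries.constantCoeff_expand,
      ← PowerSeries.coeff_zero_eq_constantCoeff_apply, hj0]
  have h1m := expand_mem_seriesOver hj hm0
  rw [mul_one] at h2
  rcases lt_trichotomy m (i.1.1 ^ 2) with h | h | h
  · obtain ⟨k, hk⟩ := Nat.exists_eq_add_of_lt h
    have h3 := (h1.shift (k + 1)).sub h2
    refine ⟨i.1.1 ^ 2, _, sub_mem (mul_mem (pow_mem hX _) h1m) h2m,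
      h3.congr rfl fun τ ↦ ?_, ?_, ?_⟩
    · rw [show k + 1 + m = i.1.1 ^ 2 by omega, Pi.sub_apply]; ring
    · rw [map_sub, hψ0, coeff_zero_mul_eq, pow_succ, PowerSeries.coeff_zero_mul_X]
      simp [ζ, Complex.exp_ne_zero]
    · rw [map_sub, hψ0, coeff_zero_mul_eq, pow_succ, PowerSeries.coeff_zero_mul_X]
      simp only [zero_mul, zero_sub, inv_neg, inv_pow, inv_inv]
      exact neg_mem (pow_mem (exp_mem_algInt (heckeIdx_pos hi).2.ne') _)
  · exact absurd ⟨i.1.1, by rw [h, sq]⟩ hsq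
  · obtain ⟨k, hk⟩ := Nat.exists_eq_add_of_lt h
    have h3 := h1.sub (h2.shift (k + 1))
    refine ⟨m, _, sub_mem h1m (mul_mem (pow_mem hX _) h2m),
      h3.congr rfl fun τ ↦ ?_, ?_, ?_⟩
    · rw [show k + 1 + i.1.1 ^ 2 = m by omega, Pi.sub_apply]; ring
    · rw [map_sub, h10, coeff_zero_mul_eq, pow_succ, PowerSeries.coeff_zero_mul_X]
      simp
    · rw [map_sub, h10, coeff_zero_mul_eq, pow_succ, PowerSeries.coeff_zero_mul_X]
      simp

/-- The diagonal restriction of the modular polynomial of level `m`, as a function of `τ`. -/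
noncomputable def modularNorm (m : ℕ) (τ : ℍ) : ℂ :=
  ∏ i ∈ heckeIdx m, (jInv τ - jInv (heckePt i τ))

lemma modularNorm_smul (m : ℕ) (γ : SL(2, ℤ)) (τ : ℍ) :
    modularNorm m (γ • τ) = modularNorm m τ := by
  have := congrArg (fun t ↦ (t.map fun x : ℂ ↦ jInv τ - x).prod)
    (map_heckePt_smul m jInv_smul γ τ)
  simp only [Multiset.map_map] at this
  rw [modularNorm, jInv_smul]
  exact this

lemma mdifferentiable_modularNorm (m : ℕ) : MDiff (modularNorm m) := by
  have : MDiff (∏ i ∈ heckeIdx m, fun τ ↦ jInv τ - jInv (heckePt i τ)) :=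
    MDifferentiable.prod fun i hi ↦
      mdifferentiable_jInv.sub (mdifferentiable_comp_heckePt hi mdifferentiable_jInv)
  convert this using 1
  ext τ
  simp [modularNorm]

lemma isIntegral_of_modularNorm_eq_zero {m : ℕ} (hm : m ≠ 0) (hsq : ¬ IsSquare m) {τ : ℍ}
    (h : modularNorm m τ = 0) : IsIntegral ℤ (jInv τ) := by
  obtain ⟨M, φ, h1, h2, h3, h4⟩ := HasUnitLead.prod fun i hi ↦ hasUnitLead_sub hsq (i := i) hi
  obtain ⟨P, hP1, hP2, hP3⟩ := exists_polynomial_of_coeff_ne_zero hm (modularNorm_smul m)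
    (mdifferentiable_modularNorm m) h1 h2 h3
  exact isIntegral_of_eval_eq_zero hP1 (hP2 ▸ h4) (leadingCoeff_ne_zero.mp (hP2 ▸ h3))
    (by rw [← hP3, h])

lemma exists_modularNorm_ne_zero {m : ℕ} (hm : m ≠ 0) (hsq : ¬ IsSquare m) :
    ∃ τ, modularNorm m τ ≠ 0 := by
  by_contra! h
  obtain ⟨M, φ, h1, h2, h3, h4⟩ := HasUnitLead.prod fun i hi ↦ hasUnitLead_sub hsq (i := i) hi
  apply h3
  have h5 : HasQ m φ 0 := h2.congr rfl fun τ ↦ by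
    have := h τ
    rw [modularNorm] at this
    simp [this]
  rw [h5.eq_zero hm, map_zero]

lemma exists_rat_polynomial_modularNorm {m : ℕ} (hm : m ≠ 0) (hsq : ¬ IsSquare m) :
    ∃ G : ℚ[X], G ≠ 0 ∧ ∀ τ, modularNorm m τ = aeval (jInv τ) G := by
  let B : Subalgebra ℚ (ℍ → ℂ) := (aeval (R := ℚ) (jInv : ℍ → ℂ)).range
  have haeval (G : ℚ[X]) (τ : ℍ) : aeval (jInv : ℍ → ℂ) G τ = aeval (jInv τ) G := by
    have := Polynomial.aeval_algHom_apply (Pi.evalAlgHom ℚ (fun _ : ℍ ↦ ℂ) τ) jInv G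
    simpa using this.symm
  have hpow (r : ℕ) : ∑ i ∈ heckeIdx m, (fun τ ↦ jInv (heckePt i τ)) ^ r ∈ B := by
    have hmem : ∑ i ∈ heckeIdx m, (fun τ ↦ jInv (heckePt i τ)) ^ r ∈ laurentOver intSubring m := by
      rw [heckeIdx, Finset.sum_sigma]
      refine sum_mem fun p hp ↦ ?_
      convert sum_pow_jInv_heckePt_mem m r p hp using 1
      ext τ
      simp
    obtain ⟨P, hP, hPj⟩ := exists_polynomial_of_mem_laurentOver hm (fun γ τ ↦ by
      have := congrArg (fun t ↦ (t.map fun x : ℂ ↦ x ^ r).sum) (map_heckePt_smul m jInv_smul γ τ)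
      simp only [Multiset.map_map] at this
      simp only [Finset.sum_apply, Pi.pow_apply]
      exact this) hmem
    obtain ⟨Q, hQ⟩ : P ∈ Polynomial.lifts (algebraMap ℚ ℂ) :=
      (lifts_iff_coeff_lifts _).mpr fun k ↦ by
        obtain ⟨z, hz⟩ := hP k
        exact ⟨z, by rw [← hz]; simp⟩
    refine ⟨Q, funext fun τ ↦ ?_⟩
    rw [hPj, ← hQ]
    simp [haeval, eval_map_algebraMap]
  have h1 := prod_sub_mem (heckeIdx m) B (fun i τ ↦ jInv (heckePt i τ)) hpow (y := jInv)
    ⟨X, by simp⟩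
  obtain ⟨G, hG⟩ := h1
  have h2 (τ : ℍ) : modularNorm m τ = aeval (jInv τ) G := by
    rw [← haeval]
    have := congrFun hG τ
    simp only [Finset.prod_apply, Pi.sub_apply] at this
    exact this.symm
  refine ⟨G, ?_, h2⟩
  rintro rfl
  obtain ⟨τ, hτ⟩ := exists_modularNorm_ne_zero hm hsq
  exact hτ (by rw [h2]; simp)

lemma exists_pow_sub_expand (p : ℕ) [hp : Fact p.Prime] (J : PowerSeries ℤ) :
    ∃ G : PowerSeries ℤ,
      J ^ p - PowerSeries.expand p hp.out.ne_zero J = PowerSeries.C (p : ℤ) * G := by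
  have h1 : PowerSeries.map (Int.castRingHom (ZMod p))
      (J ^ p - PowerSeries.expand p hp.out.ne_zero J) = 0 := by
    have h2 : ((PowerSeries.expand p hp.out.ne_zero
        (PowerSeries.map (Int.castRingHom (ZMod p)) J) : PowerSeries (ZMod p))).map
        (frobenius (ZMod p) p) = _ :=
      MvPowerSeries.map_frobenius_expand p hp.out.ne_zero
    rw [ZMod.frobenius_zmod, PowerSeries.map_id] at h2
    rw [map_sub, map_pow, PowerSeries.map_expand, sub_eq_zero]
    exact h2.symm
  choose g hg using fun n ↦ (ZMod.intCast_zmod_eq_zero_iff_dvd _ p).mp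
    (show (((J ^ p - PowerSeries.expand p hp.out.ne_zero J).coeff n : ℤ) : ZMod p) = 0 by
      have h2 := congrArg (PowerSeries.coeff n) h1
      rwa [PowerSeries.coeff_map, map_zero] at h2)
  exact ⟨PowerSeries.mk g, by ext n; rw [hg, PowerSeries.coeff_C_mul, PowerSeries.coeff_mk]⟩

/-- The point `p τ`. -/
noncomputable abbrev mulPt (p : ℕ) (τ : ℍ) : ℍ := heckePt ⟨(p, 1), 0⟩ τ

lemma mulPt_mem (p : ℕ) [hp : Fact p.Prime] : (⟨(p, 1), 0⟩ : Σ _ : ℕ × ℕ, ℕ) ∈ heckeIdx p :=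
  mem_heckeIdx.mpr ⟨⟨mul_one p, hp.out.ne_zero⟩, one_pos⟩

/-- Kronecker's congruence for Fourier expansions. -/
lemma pow_sub_div_mem_laurentOver (p : ℕ) [hp : Fact p.Prime] :
    (fun τ ↦ (jInv τ ^ p - jInv (mulPt p τ)) / p) ∈ laurentOver intSubring 1 := by
  obtain ⟨J, hJ0, hJ⟩ := exists_jSeries
  obtain ⟨G, hG⟩ := exists_pow_sub_expand p J
  have hp0 : (p : ℂ) ≠ 0 := by exact_mod_cast hp.out.ne_zero
  refine ⟨?_, p, _, map_int_mem_seriesOver G, ?_⟩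
  · simp only [div_eq_mul_inv]
    exact ((mdifferentiable_jInv.pow p).sub
      (mdifferentiable_comp_heckePt (mulPt_mem p) mdifferentiable_jInv)).mul mdifferentiable_const
  have h1 : HasQ 1 (PowerSeries.expand p hp.out.ne_zero (PowerSeries.map (Int.castRingHom ℂ) J))
      (fun τ ↦ jInv (mulPt p τ) * 𝕢 (1 : ℕ) τ ^ p) := fun τ ↦ by
    have hinj : Injective (fun n : ℕ ↦ p * n) := mul_right_injective₀ hp.out.ne_zero
    have hq : 𝕢 (1 : ℕ) (mulPt p τ) = 𝕢 (1 : ℕ) τ ^ p := by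
      rw [qParam_heckePt (mulPt_mem p), ← qParam_pow_self hp.out.ne_zero τ]
      simp [sq, pow_mul]
    beta_reduce
    rw [show jInv (mulPt p τ) * 𝕢 (1 : ℕ) τ ^ p = jInv (mulPt p τ) * 𝕢 (1 : ℕ) (mulPt p τ) by
      rw [hq]]
    refine (hinj.hasSum_iff fun n hn ↦ ?_).mp ((hasSum_congr' fun n ↦ ?_).mpr (hJ (mulPt p τ)))
    · rw [PowerSeries.coeff_expand_of_not_dvd _ _ _ fun ⟨k, hk⟩ ↦ hn ⟨k, hk.symm⟩, zero_mul]
    · rw [comp_apply, PowerSeries.coeff_expand_mul, hq, pow_mul]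
  refine (((hJ.pow p).sub h1).const_mul (p : ℂ)⁻¹).congr ?_ fun τ ↦ ?_
  · rw [← map_pow, ← PowerSeries.map_expand, ← map_sub, hG, map_mul, PowerSeries.map_C, ← mul_assoc,
      ← map_mul]
    simp [hp0]
  · simp only [Pi.sub_apply, Pi.pow_apply]
    field_simp
    ring

lemma jInv_mem_laurentOver_algInt : jInv ∈ laurentOver algInt 1 :=
  laurentOver_mono intSubring_le_algInt 1 jInv_mem_laurentOver

lemma pow_sub_mul_sub_pow_div_mem (p : ℕ) [hp : Fact p.Prime] {i : Σ _ : ℕ × ℕ, ℕ}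
    (hi : i ∈ heckeIdx p) :
    (fun τ ↦ (jInv (heckePt i τ) ^ p - jInv τ) * (jInv (heckePt i τ) - jInv τ ^ p) / p) ∈
      laurentOver algInt p := by
  have hp0 : (p : ℂ) ≠ 0 := by exact_mod_cast hp.out.ne_zero
  have hF := laurentOver_mono intSubring_le_algInt 1 (pow_sub_div_mem_laurentOver p)
  have hj := laurentOver_raise jInv_mem_laurentOver_algInt hp.out.ne_zero
  have hji := comp_heckePt_mem_laurentOver hi jInv_mem_laurentOver_algInt
  obtain ⟨⟨h1, -⟩, h3⟩ := mem_heckeIdx.mp hi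
  rcases (Nat.dvd_prime hp.out).mp (h1 ▸ dvd_mul_right i.1.1 i.1.2) with ha | ha
  · have hd : i.1.2 = p := by rw [← h1, ha, one_mul]
    convert mul_mem (comp_heckePt_mem_laurentOver hi hF) (sub_mem hji (pow_mem hj p)) using 1
    ext τ
    have h4 : mulPt p (heckePt i τ) = ((i.2 : ℤ) : ℝ) +ᵥ τ := by
      apply UpperHalfPlane.ext
      rw [coe_heckePt (mulPt_mem p), coe_heckePt hi, hd, ha, coe_vadd]
      push_cast
      field_simp
      ring
    have h5 : jInv (mulPt p (heckePt i τ)) = jInv τ := by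
      rw [h4, ← modular_T_zpow_smul, jInv_smul]
    simp only [Pi.mul_apply, Pi.sub_apply, Pi.pow_apply]
    rw [h5]
    ring
  · have hd : i.1.2 = 1 := Nat.eq_of_mul_eq_mul_left hp.out.pos (by rw [← ha, h1, mul_one, ha])
    have hi' : i = ⟨(p, 1), 0⟩ := by
      obtain ⟨⟨a, d⟩, b⟩ := i
      dsimp only at *
      subst ha hd
      obtain rfl : b = 0 := by omega
      rfl
    convert mul_mem (sub_mem (pow_mem hji p) hj) (neg_mem (laurentOver_raise hF hp.out.ne_zero))
      using 1
    ext τ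
    subst hi'
    simp only [Pi.mul_apply, Pi.sub_apply, Pi.pow_apply, Pi.neg_apply]
    ring

/-- Kronecker's congruence for values of `j`. -/
theorem isIntegral_kronecker (p : ℕ) [hp : Fact p.Prime] {i : Σ _ : ℕ × ℕ, ℕ} (hi : i ∈ heckeIdx p)
    {τ : ℍ} (hτ : IsIntegral ℤ (jInv τ)) :
    IsIntegral ℤ
      ((jInv (heckePt i τ) ^ p - jInv τ) * (jInv (heckePt i τ) - jInv τ ^ p) / p) := by
  refine isIntegral_of_permuted (heckeIdx p) hp.out.ne_zero
    (f := fun i τ ↦ (jInv (heckePt i τ) ^ p - jInv τ) * (jInv (heckePt i τ) - jInv τ ^ p) / p)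
    (fun i hi ↦ pow_sub_mul_sub_pow_div_mem p hi) (fun γ τ ↦ ?_) hτ hi
  have := congrArg (fun t ↦ (t.map fun x : ℂ ↦ (x ^ p - jInv τ) * (x - jInv τ ^ p) / p))
    (map_heckePt_smul p jInv_smul γ τ)
  simp only [Multiset.map_map] at this
  simp only [jInv_smul γ τ]
  exact this

lemma sigma_three_le (n : ℕ) : ArithmeticFunction.sigma 3 (n + 1) ≤ 16 ^ n := by
  refine (ArithmeticFunction.sigma_le_pow_succ 3 (n + 1)).trans ?_
  rw [show 16 ^ n = (2 ^ n) ^ 4 by rw [← pow_mul, mul_comm, pow_mul]; norm_num]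
  exact Nat.pow_le_pow_left Nat.lt_two_pow_self 4

lemma norm_E₄_sub_one_le {τ : ℍ} (h : ‖𝕢 (1 : ℕ) τ‖ ≤ 1 / 200) :
    ‖E₄ τ - 1‖ ≤ 261 * ‖𝕢 (1 : ℕ) τ‖ := by
  set r := ‖𝕢 (1 : ℕ) τ‖ with hr
  have hr0 : 0 ≤ r := norm_nonneg _
  have h1 := (hasSum_nat_add_iff' 1).mpr (hasQ_E₄ τ)
  have h240 : (240 : PowerSeries ℤ) = PowerSeries.C 240 := (map_ofNat _ _).symm
  have h0 : (PowerSeries.map (Int.castRingHom ℂ) (1 + 240 * sigmaSeries 3)).coeff 0 = 1 := by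
    rw [h240, PowerSeries.coeff_map, map_add, PowerSeries.coeff_C_mul]
    simp [sigmaSeries]
  have h2 (n : ℕ) : (PowerSeries.map (Int.castRingHom ℂ) (1 + 240 * sigmaSeries 3)).coeff (n + 1) =
      240 * (ArithmeticFunction.sigma 3 (n + 1) : ℂ) := by
    rw [h240, PowerSeries.coeff_map, map_add, PowerSeries.coeff_C_mul, PowerSeries.coeff_one]
    simp [sigmaSeries]
  simp only [Finset.range_one, Finset.sum_singleton, h0, pow_zero, mul_one] at h1
  have h3 : HasSum (fun n : ℕ ↦ 240 * r * (16 * r) ^ n) (240 * r * (1 - 16 * r)⁻¹) :=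
    (hasSum_geometric_of_lt_one (by positivity) (by linarith)).mul_left _
  refine (h1.norm_le_of_bounded h3 fun n ↦ ?_).trans ?_
  · rw [h2, norm_mul, norm_mul, norm_pow, ← hr, mul_pow, pow_succ]
    have : (ArithmeticFunction.sigma 3 (n + 1) : ℝ) ≤ 16 ^ n := by exact_mod_cast sigma_three_le n
    simp only [norm_ofNat, norm_natCast]
    calc 240 * (ArithmeticFunction.sigma 3 (n + 1) : ℝ) * (r ^ n * r)
        ≤ 240 * 16 ^ n * (r ^ n * r) := by gcongr
      _ = _ := by ring
  · rw [← div_eq_mul_inv, div_le_iff₀ (by linarith)]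
    nlinarith

lemma exp_sub_one_le {x : ℝ} (hx : x < 1) : Real.exp x - 1 ≤ x / (1 - x) := by
  have h1 := Real.add_one_le_exp (-x)
  have h2 : Real.exp x * Real.exp (-x) = 1 := by rw [← Real.exp_add]; simp
  rw [le_div_iff₀ (by linarith)]
  nlinarith [Real.exp_pos x]

lemma norm_tprod_sub_one_le {q : ℂ} (h : ‖q‖ ≤ 1 / 200) :
    ‖(∏' n : ℕ, (1 - q ^ (n + 1))) - 1‖ ≤ ‖q‖ * (100 / 99) := by
  set r := ‖q‖ with hr
  have hr0 : 0 ≤ r := norm_nonneg _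
  have hm := (multipliable_one_sub_pow (q := q) (by linarith)).hasProd
  refine le_of_tendsto ((hm.sub_const 1).norm) (.of_forall fun t ↦ ?_)
  have h1 := t.norm_prod_one_add_sub_one_le (fun n ↦ -q ^ (n + 1))
  simp only [← sub_eq_add_neg, norm_neg, norm_pow, ← hr] at h1
  refine h1.trans ?_
  have h2 : HasSum (fun n : ℕ ↦ r ^ (n + 1)) (r * (1 - r)⁻¹) := by
    simpa only [pow_succ'] using
      (hasSum_geometric_of_lt_one hr0 (by linarith : r < 1)).mul_left r
  have h3 : ∑ n ∈ t, r ^ (n + 1) ≤ r * (1 - r)⁻¹ :=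
    sum_le_hasSum t (fun _ _ ↦ by positivity) h2
  have h4 : r * (1 - r)⁻¹ ≤ 200 / 199 * r := by
    rw [← div_eq_mul_inv, div_le_iff₀ (by linarith)]
    nlinarith
  have h5 := exp_sub_one_le (x := 200 / 199 * r) (by linarith)
  have h6 := Real.exp_le_exp.mpr (h3.trans h4)
  refine (sub_le_sub_right h6 1).trans (h5.trans ?_)
  rw [div_le_iff₀ (by linarith)]
  nlinarith

lemma norm_tprod_pow_sub_one_le {q : ℂ} (h : ‖q‖ ≤ 1 / 200) :
    ‖(∏' n : ℕ, (1 - q ^ (n + 1))) ^ 24 - 1‖ ≤ 28 * ‖q‖ := by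
  have h0 := norm_tprod_sub_one_le h
  set r := ‖q‖ with hr
  have hr0 : 0 ≤ r := norm_nonneg _
  set P := ∏' n : ℕ, (1 - q ^ (n + 1))
  have h1 := (Finset.range 24).norm_prod_one_add_sub_one_le (fun _ ↦ P - 1)
  simp only [add_sub_cancel, Finset.prod_const, Finset.card_range, Finset.sum_const,
    nsmul_eq_mul] at h1
  have h6 : Real.exp ((24 : ℕ) * ‖P - 1‖) ≤ Real.exp (2400 / 99 * r) :=
    Real.exp_le_exp.mpr (by push_cast; linarith)
  have h5 := exp_sub_one_le (x := 2400 / 99 * r) (by linarith)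
  refine h1.trans ((sub_le_sub_right h6 1).trans (h5.trans ?_))
  rw [div_le_iff₀ (by linarith)]
  nlinarith

lemma discriminant_eq_mul_tprod_pow (τ : ℍ) :
    discriminant τ = 𝕢 (1 : ℕ) τ * (∏' n : ℕ, (1 - 𝕢 (1 : ℕ) τ ^ (n + 1))) ^ 24 := by
  rw [discriminant_eq_q_prod, Nat.cast_one,
    ← (multipliable_one_sub_pow (by simpa using norm_qParam_lt_one 1 τ)).tprod_pow]

/-- The polar part of the Fourier expansion dominates. -/
theorem norm_jInv_sub_inv_le {τ : ℍ} (h : ‖𝕢 (1 : ℕ) τ‖ ≤ 1 / 200) :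
    ‖jInv τ - (𝕢 (1 : ℕ) τ)⁻¹‖ ≤ 3000 := by
  have hE := norm_E₄_sub_one_le h
  have hP := norm_tprod_pow_sub_one_le h
  have hD := discriminant_eq_mul_tprod_pow τ
  have hD0 := discriminant_ne_zero τ
  set P := (∏' n : ℕ, (1 - 𝕢 (1 : ℕ) τ ^ (n + 1))) ^ 24
  have hq := qParam_ne_zero 1 τ
  set q := 𝕢 (1 : ℕ) τ
  set e := E₄ τ - 1 with he
  have hr0 : 0 < ‖q‖ := norm_pos_iff.mpr hq
  have hP0 : P ≠ 0 := fun h ↦ hD0 (by rw [hD, h, mul_zero])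
  have h1 : jInv τ - q⁻¹ = (e * (3 + 3 * e + e ^ 2) - (P - 1)) / (q * P) := by
    rw [jInv, hD, show E₄ τ = e + 1 by rw [he]; ring]
    field_simp
    ring
  have h2 : 0.86 ≤ ‖P‖ := by
    have := norm_sub_norm_le 1 (1 - P)
    rw [sub_sub_cancel, norm_one, norm_sub_rev] at this
    linarith
  have he1 : ‖e‖ ≤ 1.305 := by linarith
  have h3 : ‖3 + 3 * e + e ^ 2‖ ≤ 8.62 := by
    refine (norm_add₃_le).trans ?_
    rw [norm_mul, norm_pow]
    simp only [norm_ofNat]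
    nlinarith [norm_nonneg e]
  rw [h1, norm_div, norm_mul, div_le_iff₀ (by positivity)]
  calc ‖e * (3 + 3 * e + e ^ 2) - (P - 1)‖ ≤ ‖e‖ * ‖3 + 3 * e + e ^ 2‖ + ‖P - 1‖ := by
        rw [← norm_mul]; exact norm_sub_le _ _
    _ ≤ 261 * ‖q‖ * 8.62 + 28 * ‖q‖ := by gcongr
    _ ≤ 3000 * (‖q‖ * 0.86) := by nlinarith
    _ ≤ _ := by gcongr

lemma exists_qParam_eq {q : ℂ} (h0 : q ≠ 0) (h1 : ‖q‖ < 1) : ∃ τ : ℍ, 𝕢 (1 : ℕ) τ = q :=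
  ⟨⟨Function.Periodic.invQParam 1 q,
    Function.Periodic.im_invQParam_pos_of_norm_lt_one one_pos h1 h0⟩,
    by simpa using! Function.Periodic.qParam_right_inv one_ne_zero h0⟩

/-- `j - q⁻¹` as a holomorphic function of `q`. -/
lemma exists_regular_part : ∃ F : ℂ → ℂ, DifferentiableOn ℂ F (Metric.ball 0 (1 / 200)) ∧
    (∀ q ∈ Metric.ball (0 : ℂ) (1 / 200), ‖F q‖ ≤ 3000) ∧
    ∀ τ : ℍ, ‖𝕢 (1 : ℕ) τ‖ < 1 / 200 → jInv τ = (𝕢 (1 : ℕ) τ)⁻¹ + F (𝕢 (1 : ℕ) τ) := by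
  obtain ⟨J, hJ0, hJ⟩ := exists_jSeries
  set a : ℕ → ℂ := fun n ↦ (PowerSeries.map (Int.castRingHom ℂ) J).coeff n with ha
  have ha0 : a 0 = 1 := by
    simp [ha, hJ0, PowerSeries.coeff_map, -PowerSeries.coeff_zero_eq_constantCoeff]
  have hsum (τ : ℍ) : HasSum (fun n ↦ a (n + 1) * 𝕢 (1 : ℕ) τ ^ n) (jInv τ - (𝕢 (1 : ℕ) τ)⁻¹) := by
    have h1 := (hasSum_nat_add_iff' 1).mpr (hJ τ)
    have h2 := qParam_ne_zero 1 τ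
    simp only [Finset.range_one, Finset.sum_singleton, pow_zero, mul_one] at h1
    have h3 := h1.mul_right (𝕢 (1 : ℕ) τ)⁻¹
    change HasSum _ ((_ - a 0) * _) at h3
    rw [ha0, sub_mul, one_mul, mul_inv_cancel_right₀ h2] at h3
    exact (hasSum_congr' fun n ↦ by rw [pow_succ, ← mul_assoc, mul_inv_cancel_right₀ h2]).mpr h3
  set F : ℂ → ℂ := fun q ↦ ∑' n, a (n + 1) * q ^ n with hF
  have hFτ (τ : ℍ) : F (𝕢 (1 : ℕ) τ) = jInv τ - (𝕢 (1 : ℕ) τ)⁻¹ := (hsum τ).tsum_eq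
  have hdiff : DifferentiableOn ℂ F (Metric.ball 0 (1 / 200)) := by
    obtain ⟨τ, hτ⟩ := exists_qParam_eq (q := 1 / 200) (by norm_num) (by norm_num)
    have h1 := (hsum τ).summable.norm
    rw [hτ] at h1
    refine differentiableOn_tsum_of_summable_norm h1 (fun n ↦ by fun_prop) Metric.isOpen_ball
      fun n w hw ↦ ?_
    rw [norm_mul, norm_mul, norm_pow, norm_pow]
    have : ‖w‖ ≤ ‖(1 / 200 : ℂ)‖ := by
      rw [mem_ball_zero_iff] at hw
      norm_num at hw ⊢
      exact hw.le
    gcongr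
  refine ⟨F, hdiff, ?_, fun τ hτ ↦ by rw [hFτ]; ring⟩
  have hne (q : ℂ) (hq : q ∈ Metric.ball (0 : ℂ) (1 / 200)) (h0 : q ≠ 0) : ‖F q‖ ≤ 3000 := by
    rw [mem_ball_zero_iff] at hq
    obtain ⟨τ, rfl⟩ := exists_qParam_eq h0 (hq.trans (by norm_num))
    rw [hFτ]
    exact norm_jInv_sub_inv_le hq.le
  intro q hq
  by_cases h0 : q = 0
  · subst h0
    have hc := (hdiff.continuousOn.continuousAt (Metric.isOpen_ball.mem_nhds hq)).norm
    refine le_of_tendsto (hc.mono_left (nhdsWithin_le_nhds (s := {0}ᶜ))) ?_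
    filter_upwards [self_mem_nhdsWithin, nhdsWithin_le_nhds (Metric.isOpen_ball.mem_nhds hq)]
      with w hw hw' using hne w hw' hw
  · exact hne q hq h0

/-- `j` determines `q` near the cusp. -/
theorem qParam_eq_of_jInv_eq {τ τ' : ℍ} (h : ‖𝕢 (1 : ℕ) τ‖ ≤ 1 / 25000)
    (h' : ‖𝕢 (1 : ℕ) τ'‖ ≤ 1 / 25000) (hj : jInv τ = jInv τ') :
    𝕢 (1 : ℕ) τ = 𝕢 (1 : ℕ) τ' := by
  obtain ⟨F, hF, hF', hjF⟩ := exists_regular_part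
  rw [hjF τ (h.trans_lt (by norm_num)), hjF τ' (h'.trans_lt (by norm_num))] at hj
  have hq0 := qParam_ne_zero 1 τ
  have hq0' := qParam_ne_zero 1 τ'
  set q := 𝕢 (1 : ℕ) τ
  set q' := 𝕢 (1 : ℕ) τ'
  have hsub : Metric.ball q' (1 / 210) ⊆ Metric.ball 0 (1 / 200) := by
    refine Metric.ball_subset_ball' ?_
    rw [dist_zero_right]
    linarith
  have h0' : q' ∈ Metric.ball (0 : ℂ) (1 / 200) := by rw [mem_ball_zero_iff]; linarith
  have hlip := dist_le_div_mul_dist_of_mapsTo_ball (R₂ := 6000) (z := q) (hF.mono hsub)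
    (fun z hz ↦ by
      rw [mem_closedBall_iff_norm]
      refine (norm_sub_le _ _).trans ?_
      linarith [hF' z (hsub hz), hF' q' h0'])
    (by
      rw [mem_ball_iff_norm]
      refine (norm_sub_le _ _).trans_lt ?_
      linarith)
  rw [dist_eq_norm, dist_eq_norm] at hlip
  have h1 : q - q' = (F q - F q') * (q * q') := by
    field_simp at hj
    linear_combination -hj
  have h2 : ‖q - q'‖ ≤ 6000 / (1 / 210) * ‖q - q'‖ * (1 / 25000 * (1 / 25000)) := by
    conv_lhs => rw [h1, norm_mul, norm_mul]
    gcongr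
  have h3 : ‖q - q'‖ ≤ 0 := by linarith [norm_nonneg (q - q')]
  exact sub_eq_zero.mp (norm_le_zero_iff.mp h3)

lemma norm_qParam_one (τ : ℍ) : ‖𝕢 (1 : ℕ) τ‖ = (Real.exp (2 * π * τ.im))⁻¹ := by
  rw [Periodic.norm_qParam, ← Real.exp_neg]
  simp

lemma exists_smul_norm_qParam_le (τ : ℍ) : ∃ γ : SL(2, ℤ), ‖𝕢 (1 : ℕ) (γ • τ : ℍ)‖ ≤ 1 / 200 := by
  obtain ⟨γ, hγ⟩ := ModularGroup.exists_smul_mem_fd τ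
  refine ⟨γ, ?_⟩
  have h1 := ModularGroup.three_le_four_mul_im_sq_of_mem_fd hγ
  have h2 : 0.866 ≤ (γ • τ).im := by nlinarith [(γ • τ).im_pos]
  have h3 : 5.4 ≤ 2 * π * (γ • τ).im := by nlinarith [Real.pi_gt_d2]
  have h4 : (200 : ℝ) ≤ Real.exp 5.4 := by
    rw [show (5.4 : ℝ) = (5 : ℕ) * 1 + 0.4 by norm_num, Real.exp_add, Real.exp_nat_mul]
    have := Real.exp_one_gt_d9
    have h5 : (2.718 : ℝ) ^ 5 ≤ Real.exp 1 ^ 5 := by gcongr; linarith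
    have h6 := Real.add_one_le_exp (0.4 : ℝ)
    calc (200 : ℝ) ≤ 2.718 ^ 5 * 1.4 := by norm_num
      _ ≤ _ := by gcongr; linarith
  rw [norm_qParam_one, one_div]
  gcongr
  exact h4.trans (Real.exp_le_exp.mpr h3)

lemma abs_norm_jInv_sub_exp_le {τ : ℍ} (h : ‖𝕢 (1 : ℕ) τ‖ ≤ 1 / 200) :
    |‖jInv τ‖ - Real.exp (2 * π * τ.im)| ≤ 3000 := by
  have h1 := (abs_norm_sub_norm_le (jInv τ) (𝕢 (1 : ℕ) τ)⁻¹).trans (norm_jInv_sub_inv_le h)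
  rwa [norm_inv, norm_qParam_one, inv_inv] at h1

lemma eventually_lt_norm_jInv (B : ℝ) : ∀ᶠ τ in atImInfty, B < ‖jInv τ‖ := by
  have h1 : Tendsto (fun τ : ℍ ↦ Real.exp (2 * π * τ.im)) atImInfty atTop :=
    Real.tendsto_exp_atTop.comp (tendsto_comap.const_mul_atTop (by positivity))
  filter_upwards [h1.eventually_gt_atTop (B + 3000), h1.eventually_ge_atTop 200] with τ h2 h3
  have h4 := abs_norm_jInv_sub_exp_le (τ := τ) (by
    rw [norm_qParam_one, one_div]
    gcongr)
  linarith [(abs_le.mp h4).1]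

/-- The `j`-function is surjective. -/
theorem jInv_surjective : Surjective jInv := by
  intro c
  by_contra! h
  have hsub (τ : ℍ) : jInv τ - c ≠ 0 := sub_ne_zero.mpr (h τ)
  obtain ⟨w, hw⟩ := exists_const_of_invariant (f := fun τ ↦ (jInv τ - c)⁻¹)
    (fun γ τ ↦ by rw [jInv_smul])
    (by
      have h1 := mdifferentiable_jInv
      rw [UpperHalfPlane.mdifferentiable_iff] at h1 ⊢
      exact (h1.sub_const c).inv fun z hz ↦ hsub _)
    (by
      refine Asymptotics.IsBigO.of_bound 1 ?_
      filter_upwards [eventually_lt_norm_jInv (1 + ‖c‖)] with τ hτ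
      have h1 := norm_sub_norm_le (jInv τ) c
      rw [norm_inv]
      simpa using! inv_le_one_of_one_le₀ (by linarith))
  obtain ⟨τ, hτ⟩ := (eventually_lt_norm_jInv (‖w⁻¹ + c‖)).exists
  rw [← hw τ, inv_inv, sub_add_cancel] at hτ
  exact lt_irrefl _ hτ

lemma exists_jInv_eq (c : ℂ) : ∃ τ : ℍ, ‖𝕢 (1 : ℕ) τ‖ ≤ 1 / 200 ∧ jInv τ = c := by
  obtain ⟨τ, rfl⟩ := jInv_surjective c
  obtain ⟨γ, hγ⟩ := exists_smul_norm_qParam_le τ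
  exact ⟨_, hγ, jInv_smul γ τ⟩

lemma jInv_eq_of_add_int {τ τ' : ℍ} {k : ℤ} (h : (τ' : ℂ) = τ + k) : jInv τ' = jInv τ := by
  rw [show τ' = ((k : ℤ) : ℝ) +ᵥ τ from UpperHalfPlane.ext (by rw [h, coe_vadd]; push_cast; ring),
    ← modular_T_zpow_smul, jInv_smul]

lemma exists_add_int_of_jInv_eq {τ τ' : ℍ} (h : ‖𝕢 (1 : ℕ) τ‖ ≤ 1 / 200)
    (h' : ‖𝕢 (1 : ℕ) τ'‖ ≤ 1 / 200) (hj : jInv τ = jInv τ') (hb : 28000 ≤ ‖jInv τ‖) :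
    ∃ k : ℤ, (τ' : ℂ) = τ + k := by
  have hsmall {τ : ℍ} (h : ‖𝕢 (1 : ℕ) τ‖ ≤ 1 / 200) (hb : 28000 ≤ ‖jInv τ‖) :
      ‖𝕢 (1 : ℕ) τ‖ ≤ 1 / 25000 := by
    have h1 := (abs_le.mp (abs_norm_jInv_sub_exp_le h)).2
    rw [norm_qParam_one, one_div]
    gcongr
    linarith
  have h1 := qParam_eq_of_jInv_eq (hsmall h' (hj ▸ hb)) (hsmall h hb) hj.symm
  rw [Periodic.qParam, Periodic.qParam, Complex.exp_eq_exp_iff_exists_int] at h1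
  obtain ⟨k, hk⟩ := h1
  refine ⟨k, mul_left_cancel₀ two_pi_I_ne_zero ?_⟩
  rw [Nat.cast_one, ofReal_one, div_one, div_one] at hk
  rw [hk]
  ring

lemma modularNorm_eq_zero_of_fixed {m : ℕ} (hm : 0 < m) {M : Matrix (Fin 2) (Fin 2) ℤ}
    (hM : M.det = m) {τ : ℍ} (h : (M 0 0 * τ + M 0 1 : ℂ) = τ * (M 1 0 * τ + M 1 1)) :
    modularNorm m τ = 0 := by
  obtain ⟨i, hi, γ, hγ⟩ := exists_heckeMat hm M hM
  rw [modularNorm, Finset.prod_eq_zero_iff]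
  refine ⟨i, hi, ?_⟩
  have hne : (M 1 0 * τ + M 1 1 : ℂ) ≠ 0 := by
    intro h0
    have h1 : M 1 0 = 0 := by
      have := congrArg Complex.im h0
      simpa [τ.im_pos.ne'] using this
    have h2 : M 1 1 = 0 := by simpa [h1] using h0
    rw [Matrix.det_fin_two, h1, h2] at hM
    simp at hM
    omega
  have h1 := coe_smul_heckePt hi hγ τ
  rw [h, mul_div_cancel_right₀ _ hne] at h1
  rw [← jInv_smul γ (heckePt i τ), UpperHalfPlane.ext h1, sub_self]

lemma exists_fixed_of_modularNorm_eq_zero {m : ℕ} {τ : ℍ} (h : modularNorm m τ = 0)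
    (hτ : ‖𝕢 (1 : ℕ) τ‖ ≤ 1 / 200) (hb : 28000 ≤ ‖jInv τ‖) :
    ∃ M : Matrix (Fin 2) (Fin 2) ℤ, M.det = m ∧
      (M 0 0 * τ + M 0 1 : ℂ) = τ * (M 1 0 * τ + M 1 1) := by
  rw [modularNorm, Finset.prod_eq_zero_iff] at h
  obtain ⟨i, hi, h1⟩ := h
  obtain ⟨γ, hγ⟩ := exists_smul_norm_qParam_le (heckePt i τ)
  obtain ⟨k, hk⟩ := exists_add_int_of_jInv_eq hγ hτ
    (by rw [jInv_smul, ← sub_eq_zero.mp h1]) (by rwa [jInv_smul, ← sub_eq_zero.mp h1])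
  set g := ModularGroup.T ^ k * γ with hg
  have h2 : g • heckePt i τ = τ := by
    apply UpperHalfPlane.ext
    rw [hg, mul_smul, modular_T_zpow_smul, coe_vadd, hk]
    push_cast
    ring
  refine ⟨g * heckeMat i, by rw [Matrix.det_mul, det_heckeMat hi]; simp, ?_⟩
  have h3 := coe_smul_heckePt hi (γ := g) rfl τ
  rw [h2] at h3
  have h4 := τ.ne_zero
  rw [eq_div_iff (fun h0 ↦ h4 (by rw [h3, h0, div_zero]))] at h3
  exact h3.symm

lemma re_im_of_quadratic {a b c : ℤ} {τ : ℂ} (hτ : 0 < τ.im)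
    (h : (a * τ ^ 2 + b * τ + c : ℂ) = 0) :
    2 * a * τ.re = -b ∧ (a * (2 * τ.im)) ^ 2 = (4 * a * c - b ^ 2 : ℝ) := by
  have h1 := congrArg Complex.re h
  have h2 := congrArg Complex.im h
  simp [sq] at h1 h2
  have h3 : 2 * a * τ.re = -b := by
    have : τ.im * (2 * a * τ.re + b) = 0 := by linear_combination h2
    rcases mul_eq_zero.mp this with h | h
    · exact absurd h hτ.ne'
    · linarith
  refine ⟨h3, ?_⟩
  linear_combination (-4 * a) * h1 + (2 * a * τ.re + b) * h3

lemma exp_bound : (31000 : ℝ) ≤ Real.exp 10.36 := by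
  rw [show (10.36 : ℝ) = (10 : ℕ) * 1 + 0.36 by norm_num, Real.exp_add, Real.exp_nat_mul]
  have := Real.exp_one_gt_d9
  have h5 : (2.718 : ℝ) ^ 10 ≤ Real.exp 1 ^ 10 := by gcongr; linarith
  have h6 := Real.quadratic_le_exp_of_nonneg (x := 0.36) (by norm_num)
  calc (31000 : ℝ) ≤ 2.718 ^ 10 * (1 + 0.36 + 0.36 ^ 2 / 2) := by norm_num
    _ ≤ _ := by gcongr

lemma exp_gap {a b : ℝ} (ha : 0 < a) (h : 11 ≤ a ^ 2) (hab : b ^ 2 ≤ a ^ 2 - 1) :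
    6000 < Real.exp (π * a) - Real.exp (π * b) := by
  have hpi := Real.pi_gt_d2
  have ha1 : 3.3 ≤ a := by nlinarith
  have h1 : 1 / (2 * a) ≤ a - b := by
    rw [div_le_iff₀ (by positivity)]
    nlinarith [sq_nonneg (a - b)]
  have h2 : Real.exp (π * b) * (1 + π / (2 * a)) ≤ Real.exp (π * a) := by
    rw [show π * a = π * b + π * (a - b) by ring, Real.exp_add]
    gcongr
    have := Real.add_one_le_exp (π * (a - b))
    have h3 : π * (1 / (2 * a)) ≤ π * (a - b) := by gcongr
    rw [mul_one_div] at h3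
    linarith
  have h3 : 31000 * (1 + 3 * (a - 3.3)) ≤ Real.exp (π * a) := by
    rw [show π * a = π * 3.3 + π * (a - 3.3) by ring, Real.exp_add]
    have h4 : Real.exp 10.36 ≤ Real.exp (π * 3.3) := Real.exp_le_exp.mpr (by linarith)
    have h5 := Real.add_one_le_exp (π * (a - 3.3))
    have h6 : 3 * (a - 3.3) ≤ π * (a - 3.3) := by gcongr; linarith
    have := exp_bound
    gcongr
    · linarith
    · linarith
  have h4 : Real.exp (π * b) * (2 * a + π) ≤ Real.exp (π * a) * (2 * a) := by
    have := mul_le_mul_of_nonneg_right h2 (by positivity : (0 : ℝ) ≤ 2 * a)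
    rw [mul_assoc] at this
    rwa [show (1 + π / (2 * a)) * (2 * a) = 2 * a + π by field_simp] at this
  by_contra! h5
  have h6 : Real.exp (π * a) * π ≤ 6000 * (2 * a + π) := by nlinarith
  have h7 : Real.exp (π * a) * 3.14 ≤ Real.exp (π * a) * π := by gcongr
  have := Real.pi_lt_d2
  nlinarith

lemma exists_nonsquare {B C : ℤ} (hD : 11 ≤ 4 * C - B ^ 2) :
    ∃ t : ℤ, ∃ m : ℕ, 4 * (m : ℤ) = 4 * C - B ^ 2 + t ^ 2 ∧ 2 ∣ t + B ∧ t ^ 2 ≤ 9 ∧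
      ¬ IsSquare m := by
  rcases Int.even_or_odd' B with ⟨k, rfl | rfl⟩
  · by_cases h : IsSquare (C - k ^ 2).toNat
    · refine ⟨2, (C - k ^ 2 + 1).toNat, ?_, by omega, by norm_num, ?_⟩
      · rw [Int.toNat_of_nonneg (by nlinarith)]; ring
      · obtain ⟨r, hr⟩ := h
        rintro ⟨s, hs⟩
        have h1 : s * s = r * r + 1 := by
          rw [← hr, ← hs]
          have : 0 ≤ C - k ^ 2 := by nlinarith
          omega
        have h2 : r ≠ 0 := by rintro rfl; rw [Nat.mul_zero, Int.toNat_eq_zero] at hr; nlinarith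
        have h3 : r < s := by nlinarith
        nlinarith [Nat.pos_of_ne_zero h2]
    · exact ⟨0, (C - k ^ 2).toNat, by rw [Int.toNat_of_nonneg (by nlinarith)]; ring, by omega,
        by norm_num, h⟩
  · by_cases h : IsSquare (C - k ^ 2 - k).toNat
    · refine ⟨3, (C - k ^ 2 - k + 2).toNat, ?_, by omega, by norm_num, ?_⟩
      · rw [Int.toNat_of_nonneg (by nlinarith)]; ring
      · obtain ⟨r, hr⟩ := h
        rintro ⟨s, hs⟩
        have h1 : s * s = r * r + 2 := by
          rw [← hr, ← hs]
          have : 0 ≤ C - k ^ 2 - k := by nlinarith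
          omega
        have h2 : r ≠ 0 := by rintro rfl; rw [Nat.mul_zero, Int.toNat_eq_zero] at hr; nlinarith
        have h3 : r < s := by nlinarith
        nlinarith [Nat.pos_of_ne_zero h2]
    · exact ⟨1, (C - k ^ 2 - k).toNat, by rw [Int.toNat_of_nonneg (by nlinarith)]; ring, by omega,
        by norm_num, h⟩

/-- The singular modulus attached to a monic quadratic polynomial is the only one of its absolute
value among its conjugates. -/
theorem eq_of_norm_eq_of_conj {B C : ℤ} (hD : 11 ≤ 4 * C - B ^ 2) {τ : ℍ}
    (hτ : (τ ^ 2 + B * τ + C : ℂ) = 0) {y : ℂ} (hy : ‖y‖ = ‖jInv τ‖)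
    (hconj : ∀ G : ℚ[X], aeval (jInv τ) G = 0 → aeval y G = 0) : y = jInv τ := by
  obtain ⟨t, m, hm, htB, ht, hsq⟩ := exists_nonsquare hD
  have hm0 : m ≠ 0 := by rintro rfl; exact hsq ⟨0, rfl⟩
  obtain ⟨k, hk⟩ := htB
  have hfix : modularNorm m τ = 0 := by
    refine modularNorm_eq_zero_of_fixed (M := !![t - k, -C; 1, k]) (Nat.pos_of_ne_zero hm0) ?_ ?_
    · rw [Matrix.det_fin_two_of]
      obtain rfl : t = 2 * k - B := by omega
      linarith
    · have h1 : (t : ℂ) + B = 2 * k := by exact_mod_cast hk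
      simp
      linear_combination -hτ + τ * h1
  obtain ⟨G, -, hG⟩ := exists_rat_polynomial_modularNorm hm0 hsq
  obtain ⟨τ', hq', rfl⟩ := exists_jInv_eq y
  have hfix' : modularNorm m τ' = 0 := by
    rw [hG]
    exact hconj G (by rw [← hG, hfix])
  have hD' : (11 : ℝ) ≤ 4 * C - B ^ 2 := by exact_mod_cast hD
  obtain ⟨hre, him⟩ := re_im_of_quadratic (a := 1) (b := B) (c := C) τ.im_pos
    (by simpa using hτ)
  simp only [Int.cast_one, one_mul, mul_one, coe_im, coe_re] at hre him
  have hu : 3.3 ≤ 2 * τ.im := by nlinarith [τ.im_pos]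
  have hexp : 31000 ≤ Real.exp (2 * π * τ.im) := by
    refine exp_bound.trans (Real.exp_le_exp.mpr ?_)
    nlinarith [Real.pi_gt_d2]
  have hq : ‖𝕢 (1 : ℕ) τ‖ ≤ 1 / 200 := by
    rw [norm_qParam_one, one_div]
    gcongr
    linarith
  have h1 := abs_le.mp (abs_norm_jInv_sub_exp_le hq)
  have h2 := abs_le.mp (abs_norm_jInv_sub_exp_le hq')
  have hb : 28000 ≤ ‖jInv τ'‖ := by linarith
  obtain ⟨M, hM, hMτ⟩ := exists_fixed_of_modularNorm_eq_zero hfix' hq' hb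
  rw [Matrix.det_fin_two] at hM
  have hc : M 1 0 ≠ 0 := by
    intro h0
    rw [h0, Int.cast_zero, zero_mul, zero_add] at hMτ
    have h3 : M 0 0 = M 1 1 := by
      have := congrArg Complex.im hMτ
      simp at this
      have h4 : (M 0 0 : ℝ) = M 1 1 := mul_right_cancel₀ τ'.im_pos.ne' (by linarith)
      exact_mod_cast h4
    rw [h0, h3, mul_zero, sub_zero] at hM
    refine hsq ⟨(M 1 1).natAbs, ?_⟩
    zify
    rw [abs_mul_abs_self, hM]
  obtain ⟨hre', him'⟩ := re_im_of_quadratic (a := M 1 0) (b := M 1 1 - M 0 0) (c := -M 0 1)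
    τ'.im_pos (by push_cast; linear_combination -hMτ)
  simp only [coe_im, coe_re] at hre' him'
  set s := M 0 0 + M 1 1 with hs
  have him2 : (M 1 0 * (2 * τ'.im)) ^ 2 = 4 * m - (s : ℝ) ^ 2 := by
    rw [him', hs]
    have : (m : ℝ) = M 0 0 * M 1 1 - M 0 1 * M 1 0 := by exact_mod_cast hM.symm
    rw [this]; push_cast; ring
  have hmR : 4 * (m : ℝ) = 4 * C - B ^ 2 + t ^ 2 := by exact_mod_cast hm
  have htR : (t : ℝ) ^ 2 ≤ 9 := by exact_mod_cast ht
  have e1 : 2 * π * τ.im = π * (2 * τ.im) := by ring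
  have e2 : 2 * π * τ'.im = π * (2 * τ'.im) := by ring
  rw [e1] at h1
  rw [e2] at h2
  have hgap1 : (2 * τ.im) ^ 2 - 1 < (2 * τ'.im) ^ 2 := by
    by_contra! h3
    have := exp_gap (by linarith) (by linarith) h3
    linarith
  have hgap2 : (2 * τ'.im) ^ 2 < (2 * τ.im) ^ 2 + 1 := by
    by_contra! h3
    have := exp_gap (a := 2 * τ'.im) (b := 2 * τ.im) (by linarith [τ'.im_pos])
      (by linarith) (by linarith)
    linarith
  have hc1 : M 1 0 ^ 2 = 1 := by
    by_contra h3
    have h4 : 4 ≤ M 1 0 ^ 2 := by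
      have : 2 ≤ |M 1 0| := by
        by_contra! h5
        have h6 := abs_pos.mpr hc
        exact h3 (by rw [← sq_abs, show |M 1 0| = 1 by omega]; norm_num)
      rw [← sq_abs]
      nlinarith
    have h5 : (4 : ℝ) ≤ (M 1 0 : ℝ) ^ 2 := by exact_mod_cast h4
    rw [mul_pow] at him2
    nlinarith [sq_nonneg (s : ℝ)]
  have hc1R : (M 1 0 : ℝ) ^ 2 = 1 := by exact_mod_cast hc1
  rw [mul_pow, hc1R, one_mul] at him2
  have hDs : 4 * C - B ^ 2 = 4 * m - s ^ 2 := by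
    have h3 : (4 * C - B ^ 2 : ℤ) < 4 * m - s ^ 2 + 1 := by
      have : (4 * C - B ^ 2 : ℝ) < 4 * m - s ^ 2 + 1 := by linarith
      exact_mod_cast this
    have h4 : (4 * m - s ^ 2 : ℤ) < 4 * C - B ^ 2 + 1 := by
      have : (4 * m - s ^ 2 : ℝ) < 4 * C - B ^ 2 + 1 := by linarith
      exact_mod_cast this
    omega
  have himeq : τ'.im = τ.im := by
    have h3 : (2 * τ'.im) ^ 2 = (2 * τ.im) ^ 2 := by
      rw [him2, him]
      exact_mod_cast hDs.symm
    have := (sq_eq_sq₀ (by linarith [τ'.im_pos]) (by linarith)).mp h3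
    linarith
  obtain ⟨ε, hε, hε2⟩ : ∃ ε : ℤ, M 1 0 = ε ∧ ε * ε = 1 := ⟨_, rfl, by rw [← sq, hc1]⟩
  have hpar : 2 ∣ B - ε * (M 1 1 - M 0 0) := by
    have h3 : Even (B ^ 2 - s ^ 2) := ⟨2 * (C - m), by linarith⟩
    have h4 : ¬ Even ε := by
      rintro ⟨r, rfl⟩
      have : 2 * (2 * r * r) = (1 : ℤ) := by linarith
      omega
    rw [Int.even_sub, Int.even_pow' two_ne_zero, Int.even_pow' two_ne_zero, hs, Int.even_add] at h3
    rw [← even_iff_two_dvd, Int.even_sub, Int.even_mul, Int.even_sub]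
    tauto
  obtain ⟨l, hl⟩ := hpar
  refine jInv_eq_of_add_int (k := l) (Complex.ext ?_ ?_)
  · have h3 : (B : ℝ) - ε * (M 1 1 - M 0 0) = 2 * l := by exact_mod_cast hl
    rw [hε] at hre'
    push_cast at hre'
    have h4 : (ε : ℝ) * ε = 1 := by exact_mod_cast hε2
    simp
    linear_combination (1 / 2) * h3 - (1 / 2) * hre + (1 / 2) * ε * hre' - τ'.re * h4
  · simp [himeq]

lemma dvd_aeval_pow_sub {R : Type*} [CommRing R] (p : ℕ) [hp : Fact p.Prime] (f : ℤ[X]) (x : R) :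
    (p : R) ∣ aeval x f ^ p - aeval (x ^ p) f := by
  obtain ⟨g, hg⟩ : C (p : ℤ) ∣ f ^ p - expand ℤ p f := by
    rw [C_dvd_iff_dvd_coeff]
    intro n
    rw [← ZMod.intCast_zmod_eq_zero_iff_dvd, ← eq_intCast (Int.castRingHom (ZMod p)),
      ← Polynomial.coeff_map, Polynomial.map_sub, Polynomial.map_pow, Polynomial.map_expand,
      ZMod.expand_card, sub_self, coeff_zero]
  refine ⟨aeval x g, ?_⟩
  rw [← expand_aeval, ← map_pow, ← map_sub, hg]
  simp

lemma dvd_aeval_mul_aeval {R : Type*} [CommRing R] {p : ℕ} [hp : Fact p.Prime] {f g : ℤ[X]}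
    {x y : R} (hf : aeval x f = 0) (hg : aeval y g = 0)
    (h : (p : R) ∣ (y ^ p - x) * (y - x ^ p)) : (p : R) ∣ aeval y f * aeval x g := by
  have key {f : ℤ[X]} {x : R} (y : R) (hf : aeval x f = 0) :
      ∃ a b, aeval y f = p * a + (y - x ^ p) * b := by
    obtain ⟨a, ha⟩ := dvd_aeval_pow_sub p f x
    obtain ⟨b, hb⟩ := sub_dvd_eval_sub y (x ^ p) (f.map (algebraMap ℤ R))
    rw [eval_map_algebraMap, eval_map_algebraMap] at hb
    rw [hf, zero_pow hp.out.ne_zero] at ha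
    exact ⟨-a, b, by linear_combination hb - ha⟩
  obtain ⟨a, b, h1⟩ := key y hf
  obtain ⟨c, d, h2⟩ := key x hg
  obtain ⟨e, he⟩ := h
  rw [h1, h2]
  exact ⟨a * (p * c + (x - y ^ p) * d) + (y - x ^ p) * b * c - e * b * d, by
    linear_combination -b * d * he⟩

lemma isIntegral_aeval {x : ℂ} (hx : IsIntegral ℤ x) (f : ℤ[X]) : IsIntegral ℤ (aeval x f) := by
  rw [aeval_eq_sum_range]
  exact IsIntegral.sum _ fun i _ ↦ (hx.pow i).smul _

lemma exists_int_multiple {α : ℂ} (hα : IsIntegral ℤ α) (h0 : α ≠ 0) :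
    ∃ n : ℤ, n ≠ 0 ∧ ∃ β, IsIntegral ℤ β ∧ α * β = n := by
  have hq := minpoly.coeff_zero_ne_zero (A := ℚ) hα.tower_top h0
  rw [minpoly.isIntegrallyClosed_eq_field_fractions' ℚ hα, coeff_map] at hq
  refine ⟨(minpoly ℤ α).coeff 0, fun h ↦ hq (by rw [h, map_zero]),
    -aeval α (minpoly ℤ α).divX, (isIntegral_aeval hα _).neg, ?_⟩
  have h1 := congrArg (aeval α) (divX_mul_X_add (minpoly ℤ α))
  rw [minpoly.aeval, map_add, map_mul, aeval_X, aeval_C] at h1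
  simp only [algebraMap_int_eq, eq_intCast] at h1
  linear_combination -h1

lemma dvd_of_isIntegral_div {p : ℕ} (hp : p ≠ 0) {n : ℤ} (h : IsIntegral ℤ (n / p : ℂ)) :
    (p : ℤ) ∣ n := by
  have h1 : IsIntegral ℤ (n / p : ℚ) := by
    rw [← isIntegral_algebraMap_iff (algebraMap ℚ ℂ).injective]
    simpa using h
  obtain ⟨k, hk⟩ := IsIntegrallyClosed.isIntegral_iff.mp h1
  have hp' : (p : ℚ) ≠ 0 := by exact_mod_cast hp
  rw [eq_div_iff hp'] at hk
  exact ⟨k, by have : (n : ℚ) = p * k := by rw [← hk]; simp [mul_comm]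
               exact_mod_cast this⟩

lemma minpoly_eq_of_aeval_eq_zero {x y : ℂ} (hx : IsIntegral ℤ x)
    (h : aeval y (minpoly ℤ x) = 0) : minpoly ℚ x = minpoly ℚ y := by
  refine minpoly.eq_of_irreducible_of_monic (minpoly.irreducible hx.tower_top) ?_
    (minpoly.monic hx.tower_top)
  rw [minpoly.isIntegrallyClosed_eq_field_fractions' ℚ hx, aeval_map_algebraMap, h]

/-- Outside finitely many primes, elements of a finite set of algebraic integers that are related by
Frobenius are conjugate. -/
lemma exists_int_forall_minpoly_eq {T : Set ℂ} (hT : T.Finite) (hTint : ∀ x ∈ T, IsIntegral ℤ x) :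
    ∃ N : ℤ, N ≠ 0 ∧ ∀ x ∈ T, ∀ y ∈ T, ∀ p : ℕ, p.Prime → ¬ (p : ℤ) ∣ N →
      IsIntegral ℤ ((y ^ p - x) * (y - x ^ p) / p) → minpoly ℚ x = minpoly ℚ y := by
  have hα (q : ℂ × ℂ) : ∃ n : ℤ, n ≠ 0 ∧ (q ∈ T ×ˢ T → aeval q.2 (minpoly ℤ q.1) ≠ 0 →
      ∃ β, IsIntegral ℤ β ∧ aeval q.2 (minpoly ℤ q.1) * β = n) := by
    by_cases h : q ∈ T ×ˢ T ∧ aeval q.2 (minpoly ℤ q.1) ≠ 0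
    · obtain ⟨n, hn, h1⟩ := exists_int_multiple (isIntegral_aeval (hTint _ h.1.2) _) h.2
      exact ⟨n, hn, fun _ _ ↦ h1⟩
    · exact ⟨1, one_ne_zero, fun h1 h2 ↦ absurd ⟨h1, h2⟩ h⟩
  choose n hn h1 using hα
  refine ⟨∏ q ∈ (hT.prod hT).toFinset, n q, Finset.prod_ne_zero_iff.mpr fun q _ ↦ hn q,
    fun x hx y hy p hp hpN hκ ↦ ?_⟩
  have := Fact.mk hp
  have hp0 : (p : ℂ) ≠ 0 := by exact_mod_cast hp.ne_zero
  have hndvd {q : ℂ × ℂ} (hq : q ∈ T ×ˢ T) : ¬ (p : ℤ) ∣ n q := fun h ↦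
    hpN (h.trans (Finset.dvd_prod_of_mem _ (by simpa using hq)))
  by_cases hxy : aeval y (minpoly ℤ x) = 0
  · exact minpoly_eq_of_aeval_eq_zero (hTint x hx) hxy
  by_cases hyx : aeval x (minpoly ℤ y) = 0
  · exact (minpoly_eq_of_aeval_eq_zero (hTint y hy) hyx).symm
  exfalso
  obtain ⟨β, hβ, hβ'⟩ := h1 (x, y) ⟨hx, hy⟩ hxy
  obtain ⟨γ, hγ, hγ'⟩ := h1 (y, x) ⟨hy, hx⟩ hyx
  have h2 : IsIntegral ℤ (aeval y (minpoly ℤ x) * aeval x (minpoly ℤ y) / p) := by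
    let x' : integralClosure ℤ ℂ := ⟨x, hTint x hx⟩
    let y' : integralClosure ℤ ℂ := ⟨y, hTint y hy⟩
    have hval (f : ℤ[X]) (z : integralClosure ℤ ℂ) : ((aeval z f : integralClosure ℤ ℂ) : ℂ) =
        aeval (z : ℂ) f := (aeval_algebraMap_apply ℂ z f).symm
    obtain ⟨e, he⟩ := dvd_aeval_mul_aeval (p := p) (x := x') (y := y') (f := minpoly ℤ x)
      (g := minpoly ℤ y) (Subtype.ext (by rw [hval]; exact minpoly.aeval ℤ x))
      (Subtype.ext (by rw [hval]; exact minpoly.aeval ℤ y))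
      ⟨⟨_, hκ⟩, Subtype.ext (by simp [x', y']; field_simp)⟩
    have h3 := congrArg (Subtype.val) he
    simp only [MulMemClass.coe_mul, hval] at h3
    rw [h3]
    have h4 : (((p : integralClosure ℤ ℂ) : ℂ) * e) / p = e := mul_div_cancel_left₀ _ hp0
    rw [h4]
    exact e.2
  have h3 : IsIntegral ℤ (((n (x, y) * n (y, x) : ℤ) : ℂ) / p) := by
    have h4 := (h2.mul hβ).mul hγ
    rwa [show aeval y (minpoly ℤ x) * aeval x (minpoly ℤ y) / p * β * γ =
      ((n (x, y) * n (y, x) : ℤ) : ℂ) / p by push_cast; rw [← hβ', ← hγ']; ring] at h4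
  rcases (Nat.prime_iff_prime_int.mp hp).dvd_or_dvd (dvd_of_isIntegral_div hp.ne_zero h3)
    with h | h
  · exact hndvd ⟨hx, hy⟩ h
  · exact hndvd ⟨hy, hx⟩ h

/-- An algebraic number that is determined among its conjugates by its absolute value is a
polynomial in each of its powers. -/
lemma exists_eq_aeval_pow {x : ℂ} (hx : IsIntegral ℚ x)
    (h : ∀ y : ℂ, ‖y‖ = ‖x‖ → (∀ G : ℚ[X], aeval x G = 0 → aeval y G = 0) → y = x) {n : ℕ}
    (hn : n ≠ 0) : ∃ P : ℚ[X], x = aeval (x ^ n) P := by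
  set K := IntermediateField.adjoin ℚ {x ^ n}
  have hxK : IsIntegral K x := hx.tower_top
  have hw : x ^ n ∈ K := IntermediateField.mem_adjoin_simple_self ℚ _
  have hroot : (minpoly K x).rootSet ℂ ⊆ {x} := by
    intro z hz
    have hz0 : aeval z (minpoly K x) = 0 := (mem_rootSet.mp hz).2
    have hdvd {G : K[X]} (hG : aeval x G = 0) : aeval z G = 0 :=
      aeval_eq_zero_of_dvd_aeval_eq_zero (minpoly.dvd K x hG) hz0
    refine h z ?_ fun G hG ↦ ?_
    · have h1 := hdvd (G := X ^ n - C ⟨x ^ n, hw⟩) (by simp)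
      simp [sub_eq_zero] at h1
      have h2 := congrArg norm h1
      rw [norm_pow, norm_pow] at h2
      exact (pow_left_inj₀ (norm_nonneg _) (norm_nonneg _) hn).mp h2
    · have h1 := hdvd (G := G.map (algebraMap ℚ K)) (by rw [aeval_map_algebraMap, hG])
      rwa [aeval_map_algebraMap] at h1
  have hcard := card_rootSet_eq_natDegree (minpoly.irreducible hxK).separable
    (IsAlgClosed.splits ((minpoly K x).map (algebraMap K ℂ)))
  have h1 : (minpoly K x).natDegree ≤ 1 := by
    rw [← hcard, ← Nat.card_eq_fintype_card]
    simpa using Set.ncard_le_ncard hroot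
  have h2 := minpoly.natDegree_pos hxK
  have h3 : x ∈ K := by
    obtain ⟨k, hk⟩ := minpoly.natDegree_eq_one_iff.mp (by omega : (minpoly K x).natDegree = 1)
    rw [← hk]
    exact k.2
  have h4 : x ∈ K.toSubalgebra := h3
  rw [IntermediateField.adjoin_simple_toSubalgebra_of_isAlgebraic (hx.pow n).isAlgebraic,
    Algebra.adjoin_singleton_eq_range_aeval] at h4
  obtain ⟨P, hP⟩ := h4
  exact ⟨P, hP.symm⟩

/-- A primitive binary quadratic form represents primitively integers prime to any given one. -/
lemma exists_coprime_represented {a b c N : ℤ} (hN : N ≠ 0) (h : Int.gcd a (Int.gcd b c) = 1) :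
    ∃ u v : ℤ, IsCoprime u v ∧ IsCoprime (a * u ^ 2 + b * u * v + c * v ^ 2) N := by
  classical
  set S := N.natAbs.primeFactors
  set U := S.filter fun r : ℕ ↦ (r : ℤ) ∣ a ∧ ¬ (r : ℤ) ∣ c
  set V := S.filter fun r : ℕ ↦ ¬ (r : ℤ) ∣ a
  have hdvd {W : Finset ℕ} (hW : W ⊆ S) {r : ℕ} (hr : r.Prime) :
      (r : ℤ) ∣ ((∏ q ∈ W, q : ℕ) : ℤ) ↔ r ∈ W := by
    rw [Int.natCast_dvd_natCast, hr.prime.dvd_finsetProd_iff]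
    constructor
    · rintro ⟨q, hq, hrq⟩
      rwa [(Nat.prime_dvd_prime_iff_eq hr (Nat.prime_of_mem_primeFactors (hW hq))).mp hrq]
    · exact fun hr ↦ ⟨r, hr, dvd_rfl⟩
  have hU : U ⊆ S := Finset.filter_subset _ _
  have hV : V ⊆ S := Finset.filter_subset _ _
  have hdU {r : ℕ} (hr : r.Prime) := hdvd hU hr
  have hdV {r : ℕ} (hr : r.Prime) := hdvd hV hr
  refine ⟨((∏ q ∈ U, q : ℕ) : ℤ), ((∏ q ∈ V, q : ℕ) : ℤ), ?_, ?_⟩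
  · rw [Int.isCoprime_iff_gcd_eq_one]
    by_contra h1
    obtain ⟨r, hr, hr1⟩ := Nat.exists_prime_and_dvd h1
    have h2 := (hdU hr).mp ((Int.natCast_dvd_natCast.mpr hr1).trans (Int.gcd_dvd_left _ _))
    have h3 := (hdV hr).mp ((Int.natCast_dvd_natCast.mpr hr1).trans (Int.gcd_dvd_right _ _))
    exact (Finset.mem_filter.mp h3).2 (Finset.mem_filter.mp h2).2.1
  · set u : ℤ := ((∏ q ∈ U, q : ℕ) : ℤ)
    set v : ℤ := ((∏ q ∈ V, q : ℕ) : ℤ)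
    rw [Int.isCoprime_iff_gcd_eq_one]
    by_contra h1
    obtain ⟨r, hr, hr1⟩ := Nat.exists_prime_and_dvd h1
    have h2 := (Int.natCast_dvd_natCast.mpr hr1).trans (Int.gcd_dvd_left _ _)
    have h3 := (Int.natCast_dvd_natCast.mpr hr1).trans (Int.gcd_dvd_right _ _)
    have hrS : r ∈ S := Nat.mem_primeFactors.mpr
      ⟨hr, by simpa using Int.natAbs_dvd_natAbs.mpr h3, by simpa using hN⟩
    have hp := Nat.prime_iff_prime_int.mp hr
    have hu : (r : ℤ) ∣ u ↔ (r : ℤ) ∣ a ∧ ¬ (r : ℤ) ∣ c := by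
      rw [hdU hr, Finset.mem_filter]; tauto
    have hv : (r : ℤ) ∣ v ↔ ¬ (r : ℤ) ∣ a := by
      rw [hdV hr, Finset.mem_filter]; tauto
    by_cases ha : (r : ℤ) ∣ a
    · have hv' : ¬ (r : ℤ) ∣ v := by tauto
      have h4 : (r : ℤ) ∣ (b * u + c * v) * v := by
        have h5 := h2.sub (ha.mul_right (u ^ 2))
        rwa [show a * u ^ 2 + b * u * v + c * v ^ 2 - a * u ^ 2 = (b * u + c * v) * v by ring] at h5
      have h5 := (hp.dvd_or_dvd h4).resolve_right hv'
      by_cases hc : (r : ℤ) ∣ c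
      · have hb := (hp.dvd_or_dvd ((dvd_add_left (hc.mul_right v)).mp h5)).resolve_right (by tauto)
        have h6 := Int.dvd_coe_gcd ha (Int.dvd_coe_gcd hb hc)
        rw [h] at h6
        exact hp.not_dvd_one (by simpa using h6)
      · have hu' : (r : ℤ) ∣ u := hu.mpr ⟨ha, hc⟩
        rcases hp.dvd_or_dvd ((dvd_add_right (hu'.mul_left b)).mp h5) with h6 | h6
        · exact hc h6
        · exact hv' h6
    · have hv' := hv.mpr ha
      have h4 : (r : ℤ) ∣ a * u ^ 2 := by
        have h5 := h2.sub (hv'.mul_right (b * u + c * v))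
        rwa [show a * u ^ 2 + b * u * v + c * v ^ 2 - v * (b * u + c * v) = a * u ^ 2 by ring] at h5
      rcases hp.dvd_or_dvd h4 with h5 | h5
      · exact ha h5
      · exact absurd (hu.mp (hp.dvd_of_dvd_pow h5)).1 ha

/-- `τ` is a root of the positive definite form with coefficients `a`, `b`, `c`. -/
structure IsFormRoot (a b c : ℤ) (τ : ℍ) : Prop where
  pos : 0 < a
  eq_zero : (a * (τ : ℂ) ^ 2 + b * τ + c : ℂ) = 0

/-- The values of `jInv` at the imaginary quadratic points where a form of discriminant `Δ`
vanishes. -/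
def jValues (Δ : ℤ) : Set ℂ :=
  {x | ∃ τ a b c, IsFormRoot a b c τ ∧ b ^ 2 - 4 * a * c = Δ ∧ x = jInv τ}

namespace IsFormRoot

variable {a b c : ℤ} {τ : ℍ}

lemma re_eq (h : IsFormRoot a b c τ) : 2 * a * τ.re = -b :=
  (re_im_of_quadratic τ.im_pos h.eq_zero).1

lemma im_sq (h : IsFormRoot a b c τ) : (a * (2 * τ.im)) ^ 2 = (4 * a * c - b ^ 2 : ℝ) :=
  (re_im_of_quadratic τ.im_pos h.eq_zero).2

lemma disc_neg (h : IsFormRoot a b c τ) : b ^ 2 - 4 * a * c < 0 := by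
  have h1 := h.im_sq
  have h2 : (0 : ℝ) < a := by exact_mod_cast h.pos
  have h3 := τ.im_pos
  have h4 : (0 : ℝ) < 4 * a * c - b ^ 2 := by rw [← h1]; positivity
  have h5 : 0 < 4 * a * c - b ^ 2 := by exact_mod_cast h4
  omega

lemma unique {c' : ℤ} {τ' : ℍ} (h : IsFormRoot a b c τ) (h' : IsFormRoot a b c' τ')
    (hd : b ^ 2 - 4 * a * c = b ^ 2 - 4 * a * c') : τ = τ' := by
  have ha : (0 : ℝ) < a := by exact_mod_cast h.pos
  have hd' : (b ^ 2 - 4 * a * c : ℝ) = b ^ 2 - 4 * a * c' := by exact_mod_cast hd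
  have h1 := τ.im_pos
  have h2 := τ'.im_pos
  apply UpperHalfPlane.ext
  apply Complex.ext
  · have := h.re_eq.trans h'.re_eq.symm
    exact mul_left_cancel₀ (by positivity) this
  · have h3 : (a * (2 * τ.im)) ^ 2 = (a * (2 * τ'.im)) ^ 2 := by
      rw [h.im_sq, h'.im_sq]; linarith
    have h4 := (pow_left_inj₀ (by positivity) (by positivity) two_ne_zero).mp h3
    have h5 := mul_left_cancel₀ ha.ne' h4
    exact mul_left_cancel₀ two_ne_zero h5

lemma smul (h : IsFormRoot a b c τ) (g : SL(2, ℤ)) :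
    IsFormRoot (a * g 1 1 ^ 2 - b * g 1 0 * g 1 1 + c * g 1 0 ^ 2)
      (-2 * a * g 1 1 * g 0 1 + b * (g 1 1 * g 0 0 + g 1 0 * g 0 1) - 2 * c * g 0 0 * g 1 0)
      (a * g 0 1 ^ 2 - b * g 0 0 * g 0 1 + c * g 0 0 ^ 2) (g • τ) := by
  have hdet : g 0 0 * g 1 1 - g 0 1 * g 1 0 = 1 := by
    rw [← Matrix.det_fin_two]; exact g.2
  constructor
  · have h1 := h.disc_neg
    have h2 := h.pos
    have h3 : 0 < 4 * a * (a * g 1 1 ^ 2 - b * g 1 0 * g 1 1 + c * g 1 0 ^ 2) := by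
      rw [show 4 * a * (a * g 1 1 ^ 2 - b * g 1 0 * g 1 1 + c * g 1 0 ^ 2) =
        (2 * a * g 1 1 - b * g 1 0) ^ 2 + (4 * a * c - b ^ 2) * g 1 0 ^ 2 by ring]
      by_cases h0 : g 1 0 = 0
      · have h4 : g 1 1 ≠ 0 := fun h4 ↦ by simp [h0, h4] at hdet
        rw [h0]
        have h5 : 0 < (2 * a * g 1 1) ^ 2 := by positivity
        linarith
      · have : 0 < 4 * a * c - b ^ 2 := by omega
        positivity
    exact pos_of_mul_pos_right h3 (by omega)
  · have hne : (g 1 0 * τ + g 1 1 : ℂ) ≠ 0 := by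
      intro h0
      have h1 : g 1 0 = 0 := by
        have := congrArg Complex.im h0
        simpa [τ.im_pos.ne'] using this
      have h2 : g 1 1 = 0 := by simpa [h1] using h0
      simp [h1, h2] at hdet
    have hdet' : (g 0 0 * g 1 1 - g 0 1 * g 1 0 : ℂ) = 1 := by exact_mod_cast hdet
    rw [coe_specialLinearGroup_apply]
    simp only [algebraMap_int_eq, eq_intCast, ofReal_intCast]
    push_cast
    field_simp
    linear_combination (g 0 0 * g 1 1 - g 0 1 * g 1 0 : ℂ) ^ 2 * h.eq_zero

lemma smul_disc (g : SL(2, ℤ)) :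
    (-2 * a * g 1 1 * g 0 1 + b * (g 1 1 * g 0 0 + g 1 0 * g 0 1) - 2 * c * g 0 0 * g 1 0) ^ 2 -
      4 * (a * g 1 1 ^ 2 - b * g 1 0 * g 1 1 + c * g 1 0 ^ 2) *
        (a * g 0 1 ^ 2 - b * g 0 0 * g 0 1 + c * g 0 0 ^ 2) = b ^ 2 - 4 * a * c := by
  have hdet : g 0 0 * g 1 1 - g 0 1 * g 1 0 = 1 := by
    rw [← Matrix.det_fin_two]; exact g.2
  linear_combination (b ^ 2 - 4 * a * c) * (g 0 0 * g 1 1 - g 0 1 * g 1 0 + 1) * hdet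

lemma isIntegral_jInv (h : IsFormRoot a b c τ) (hΔ : 11 ≤ |b ^ 2 - 4 * a * c|) :
    IsIntegral ℤ (jInv τ) := by
  rw [abs_of_neg h.disc_neg] at hΔ
  obtain ⟨t, m, h1, ⟨k, hk⟩, -, hsq⟩ := exists_nonsquare (B := b) (C := a * c) (by linarith)
  have hm : m ≠ 0 := by rintro rfl; simp at hsq
  refine isIntegral_of_modularNorm_eq_zero hm hsq (modularNorm_eq_zero_of_fixed
    (M := !![k - b, -c; a, k]) (Nat.pos_of_ne_zero hm) ?_ ?_)
  · rw [Matrix.det_fin_two_of]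
    obtain rfl : t = 2 * k - b := by linarith
    linarith
  · simp
    linear_combination -h.eq_zero

end IsFormRoot

lemma finite_jValues (Δ : ℤ) : (jValues Δ).Finite := by
  have hsub (q : ℤ × ℤ) : {τ : ℍ | ∃ c, IsFormRoot q.1 q.2 c τ ∧
      q.2 ^ 2 - 4 * q.1 * c = Δ}.Subsingleton := by
    rintro τ ⟨c, h1, h2⟩ τ' ⟨c', h1', h2'⟩
    exact h1.unique h1' (h2.trans h2'.symm)
  refine ((Finset.finite_toSet (Finset.Icc 1 (-Δ) ×ˢ Finset.Icc Δ (-Δ))).biUnion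
    fun q _ ↦ (hsub q).finite.image jInv).subset ?_
  rintro x ⟨τ, a, b, c, h, hd, rfl⟩
  obtain ⟨g, hg⟩ := ModularGroup.exists_smul_mem_fd τ
  have h1 := h.smul g
  have h2 := (IsFormRoot.smul_disc (a := a) (b := b) (c := c) g).trans hd
  rw [← jInv_smul g]
  generalize g • τ = σ at *
  generalize a * g 1 1 ^ 2 - b * g 1 0 * g 1 1 + c * g 1 0 ^ 2 = a' at *
  generalize -2 * a * g 1 1 * g 0 1 + b * (g 1 1 * g 0 0 + g 1 0 * g 0 1) -
    2 * c * g 0 0 * g 1 0 = b' at *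
  generalize a * g 0 1 ^ 2 - b * g 0 0 * g 0 1 + c * g 0 0 ^ 2 = c' at *
  have ha : (1 : ℝ) ≤ a' := by exact_mod_cast h1.pos
  have h3 := ModularGroup.three_le_four_mul_im_sq_of_mem_fd hg
  have h4 : |2 * σ.re| ≤ 1 := by
    rw [abs_mul, abs_two]; linarith [hg.2]
  have h5 : |(b' : ℝ)| ≤ a' := by
    rw [← abs_neg, ← h1.re_eq, show 2 * a' * σ.re = a' * (2 * σ.re) by ring, abs_mul,
      abs_of_pos (by linarith)]
    exact mul_le_of_le_one_right (by linarith) h4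
  have h6 : (a' : ℝ) ≤ -Δ := by
    have h7 := h1.im_sq
    rw [← h2]
    push_cast
    have h8 := mul_le_mul_of_nonneg_left h3 (sq_nonneg (a' : ℝ))
    nlinarith
  have h7 : a' ≤ -Δ := by exact_mod_cast h6
  have h8 : |b'| ≤ a' := by exact_mod_cast h5
  have h9 := abs_le.mp h8
  have h10 := h1.pos
  refine Set.mem_biUnion (x := (a', b')) ?_ ⟨σ, ⟨c', h1, h2⟩, rfl⟩
  simp only [Finset.coe_product, Finset.coe_Icc, Set.mem_prod, Set.mem_Icc]
  omega

lemma minpoly_jInv_eq {Δ N : ℤ} (hΔ : 11 ≤ |Δ|)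
    (hN : ∀ x ∈ jValues Δ, ∀ y ∈ jValues Δ, ∀ p : ℕ, p.Prime → ¬ (p : ℤ) ∣ N →
      IsIntegral ℤ ((y ^ p - x) * (y - x ^ p) / p) → minpoly ℚ x = minpoly ℚ y) (A : ℕ) :
    IsCoprime (A : ℤ) N → ∀ (B C : ℤ) (τ τ₀ : ℍ), IsFormRoot A B C τ →
      B ^ 2 - 4 * A * C = Δ → IsFormRoot 1 B (A * C) τ₀ →
        minpoly ℚ (jInv τ) = minpoly ℚ (jInv τ₀) := by
  induction A using induction_on_primes with
  | zero => exact fun _ _ _ _ _ h ↦ absurd h.pos (by simp)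
  | one =>
    intro _ B C τ τ₀ h _ h₀
    rw [Nat.cast_one] at h
    rw [h.unique h₀ (by push_cast; ring)]
  | prime_mul p A hp ih =>
    intro hA B C τ τ₀ h hd h₀
    have := Fact.mk hp
    have hp0 : (p : ℂ) ≠ 0 := by exact_mod_cast hp.ne_zero
    push_cast at hA h hd h₀
    have hcoe : (mulPt p τ : ℂ) = p * τ := by
      rw [coe_heckePt (mulPt_mem p)]; simp
    have h1 : IsFormRoot A B (p * C) (mulPt p τ) := by
      refine ⟨pos_of_mul_pos_right h.pos (by positivity), ?_⟩
      have h2 := h.eq_zero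
      rw [hcoe]
      push_cast at h2 ⊢
      linear_combination p * h2
    have hd1 : B ^ 2 - 4 * A * (p * C) = Δ := by rw [← hd]; ring
    rw [← ih hA.of_mul_left_right B (p * C) (mulPt p τ) τ₀ h1 hd1
      (by rwa [← mul_assoc, mul_comm (A : ℤ)])]
    refine hN _ ⟨τ, _, _, _, h, hd, rfl⟩ _ ⟨mulPt p τ, _, _, _, h1, hd1, rfl⟩ p hp
      (fun h2 ↦ ?_) (isIntegral_kronecker p (mulPt_mem p) (h.isIntegral_jInv (by rwa [hd])))
    exact (Nat.prime_iff_prime_int.mp hp).not_isUnit (hA.of_mul_left_left.isUnit_of_dvd' dvd_rfl h2)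

/-- Every singular modulus is conjugate to the dominant one. -/
lemma exists_minpoly_eq {a b c : ℤ} {τ : ℍ} (h : IsFormRoot a b c τ)
    (hprim : Int.gcd a (Int.gcd b c) = 1) (hΔ : 11 ≤ |b ^ 2 - 4 * a * c|) :
    ∃ (B C : ℤ) (τ₀ : ℍ), IsFormRoot 1 B C τ₀ ∧ B ^ 2 - 4 * 1 * C = b ^ 2 - 4 * a * c ∧
      minpoly ℚ (jInv τ) = minpoly ℚ (jInv τ₀) := by
  obtain ⟨N, hN0, hN⟩ := exists_int_forall_minpoly_eq (finite_jValues (b ^ 2 - 4 * a * c)) (by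
    rintro x ⟨τ, a', b', c', h, hd, rfl⟩
    exact h.isIntegral_jInv (by rwa [hd]))
  obtain ⟨u, v, huv, hA⟩ := exists_coprime_represented hN0 hprim
  obtain ⟨g, -, hg⟩ := ModularGroup.bottom_row_surj (R := ℤ) (a := ![-v, u])
    (by simpa using huv.symm.neg_left)
  have hg0 : g 1 0 = -v := congrFun hg 0
  have hg1 : g 1 1 = u := congrFun hg 1
  have h1 := h.smul g
  have h2 := IsFormRoot.smul_disc (a := a) (b := b) (c := c) g
  rw [show a * u ^ 2 + b * u * v + c * v ^ 2 =
    a * g 1 1 ^ 2 - b * g 1 0 * g 1 1 + c * g 1 0 ^ 2 by rw [hg0, hg1]; ring] at hA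
  rw [← jInv_smul g]
  generalize g • τ = σ at *
  generalize a * g 1 1 ^ 2 - b * g 1 0 * g 1 1 + c * g 1 0 ^ 2 = A at *
  generalize -2 * a * g 1 1 * g 0 1 + b * (g 1 1 * g 0 0 + g 1 0 * g 0 1) -
    2 * c * g 0 0 * g 1 0 = B at *
  generalize a * g 0 1 ^ 2 - b * g 0 0 * g 0 1 + c * g 0 0 ^ 2 = C at *
  obtain ⟨A, rfl⟩ := Int.eq_ofNat_of_zero_le h1.pos.le
  have hA0 : (0 : ℝ) < A := by exact_mod_cast h1.pos
  let τ₀ : ℍ := ⟨A * σ, by simpa using mul_pos hA0 σ.im_pos⟩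
  have h3 : IsFormRoot 1 B (A * C) τ₀ := by
    refine ⟨one_pos, ?_⟩
    have h4 := h1.eq_zero
    change ((1 : ℤ) * (A * σ : ℂ) ^ 2 + B * (A * σ) + (A * C : ℤ) : ℂ) = 0
    push_cast at h4 ⊢
    linear_combination A * h4
  exact ⟨B, A * C, τ₀, h3, by rw [← h2]; ring, minpoly_jInv_eq hΔ hN A hA B C σ τ₀ h1 h2 h3⟩

lemma mem_adjoin_pow_of_isFormRoot {a b c : ℤ} {τ : ℍ} (h : IsFormRoot a b c τ)
    (hprim : Int.gcd a (Int.gcd b c) = 1) (hΔ : 11 ≤ |b ^ 2 - 4 * a * c|) {n : ℕ} (hn : n ≠ 0) :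
    jInv τ ∈ IntermediateField.adjoin ℚ {jInv τ ^ n} := by
  obtain ⟨B, C, τ₀, h₀, hd, hmin⟩ := exists_minpoly_eq h hprim hΔ
  have hD : 11 ≤ 4 * C - B ^ 2 := by
    rw [abs_of_neg h.disc_neg] at hΔ; linarith
  have hroot : (τ₀ ^ 2 + B * τ₀ + C : ℂ) = 0 := by simpa using h₀.eq_zero
  have hTint : IsIntegral ℤ (jInv τ₀) := h₀.isIntegral_jInv (by rwa [hd])
  obtain ⟨P, hP⟩ := exists_eq_aeval_pow (x := jInv τ₀) hTint.tower_top
    (fun y hy hconj ↦ eq_of_norm_eq_of_conj hD hroot hy hconj) hn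
  have h1 : aeval (jInv τ₀) (X - P.comp (X ^ n)) = 0 := by
    rw [map_sub, aeval_comp, aeval_X, map_pow, aeval_X, ← hP, sub_self]
  have h2 : aeval (jInv τ) (X - P.comp (X ^ n)) = 0 := by
    rw [← minpoly.dvd_iff] at h1 ⊢
    rwa [hmin]
  rw [map_sub, aeval_comp, aeval_X, map_pow, aeval_X, sub_eq_zero] at h2
  have h3 := IntermediateField.algebra_adjoin_le_adjoin ℚ _
    (aeval_mem_adjoin_singleton (p := P) ℚ (jInv τ ^ n))
  rwa [← h2] at h3

end SingularModuli

theorem adjoin_singular_modulus_eq_adjoin_zpow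
    (x : ℂ) (Δ : ℤ) (hx : IsSingularModulus x Δ) (h11 : 11 ≤ |Δ|)
    (n : ℤ) (hn : n ≠ 0) :
    IntermediateField.adjoin ℚ {x} = IntermediateField.adjoin ℚ {x ^ n} := by
  obtain ⟨τ, hτ, ⟨a, b, c, ha, hprim, h0, rfl⟩, rfl⟩ := hx
  have hx : klein τ = SingularModuli.jInv ⟨τ, hτ⟩ := SingularModuli.klein_coe ⟨τ, hτ⟩
  have hmem := SingularModuli.mem_adjoin_pow_of_isFormRoot (τ := ⟨τ, hτ⟩) ⟨ha, h0⟩ hprim h11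
    (Int.natAbs_ne_zero.mpr hn)
  rw [← hx] at hmem
  apply le_antisymm
  · refine IntermediateField.adjoin_simple_le_iff.mpr
      (IntermediateField.adjoin_simple_le_iff.mpr ?_ hmem)
    have h1 := IntermediateField.mem_adjoin_simple_self ℚ (klein τ ^ n)
    rcases Int.natAbs_eq n with h2 | h2
    · rwa [← zpow_natCast, ← h2]
    · rw [← zpow_natCast, show ((n.natAbs : ℕ) : ℤ) = -n by omega, zpow_neg]
      exact inv_mem h1
  · rw [IntermediateField.adjoin_simple_le_iff]
    exact zpow_mem (IntermediateField.mem_adjoin_simple_self ℚ _) n
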